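/- arXiv:math/0306286 — 4 statements merged into one kernel-verified Lean document; each statement's English description precedes it below -/
import Mathlib

section
/- Let x_1 be the least zero of the generalized Laguerre polynomial L_k^{(α)} with α > −1. Then x_1 > V² + 3·V^{4/3}·(U² − V²)^{−1/3}, where V = √(k+α+1) − √k and U = √(k+α+1) + √k. -/
/-- The generalized Laguerre polynomial `L_k^{(α)}` as a real function:
`L_k^{(α)}(x) = ∑_{i=0}^{k} ((−1)^i / i!) · (∏_{j=1}^{k−i} (α + i + j))/(k−i)! · x^i`. -/
noncomputable def laguerre (k : ℕ) (α : ℝ) (x : ℝ) : ℝ :=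
  ∑ i ∈ Finset.range (k + 1),
    ((-1 : ℝ) ^ i / (Nat.factorial i)) *
      ((∏ j ∈ Finset.range (k - i), (α + (i : ℝ) + (j : ℝ) + 1)) /
        (Nat.factorial (k - i))) * x ^ i


/-- key inequality in reduced variables -/
lemma key_pe (p e : ℝ) (he : 4 ≤ e) (hep : e ≤ p) (hlow : p * p - 27 ≤ e * p) :
    0 < e - 4 + (4 * e / p - 27 / p + 108 / p ^ 2) ∧
    (e - 4) * (e ^ 2 + 4 * e - 68 + 36 * e / p + 972 / p ^ 2) <
      5 * p / 4 * (e - 4 + (4 * e / p - 27 / p + 108 / p ^ 2)) ^ 2 := by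
  have hp : 4 ≤ p := le_trans he hep
  have hp0 : 0 < p := by linarith
  set z := 4 * e / p - 27 / p + 108 / p ^ 2 with hz
  have hzp : z * p ^ 2 = 4 * e * p - 27 * p + 108 := by
    rw [hz]; field_simp
  have hz0 : 0 < z := by
    have : 0 < z * p ^ 2 := by
      rw [hzp]
      by_cases h7 : p ≤ 7
      · nlinarith
      · nlinarith
    by_contra hcon
    nlinarith [sq_nonneg p]
  set W := e ^ 2 + 4 * e - 68 + 36 * e / p + 972 / p ^ 2 with hW
  have hWp : W * p ^ 2 = (e ^ 2 + 4 * e - 68) * p ^ 2 + 36 * e * p + 972 := by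
    rw [hW]; field_simp
  have hf : 0 ≤ e - 4 := by linarith
  refine ⟨by linarith, ?_⟩
  have hp2 : 0 < p ^ 2 := by positivity
  by_cases h7 : p ≤ 7
  · have h1 : W < 5 * p * z := by
      have : W * p ^ 2 < 5 * p * z * p ^ 2 := by
        have : 5 * p * z * p ^ 2 = 5 * p * (4 * e * p - 27 * p + 108) := by rw [← hzp]; ring
        rw [this, hWp]
        have key : 0 < (16 * e - e ^ 2 - 67) * p ^ 2 + 540 * p - 36 * e * p - 972 := by
          have e1 : 0 ≤ (e - 4) * (p - e) := mul_nonneg hf (by linarith)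
          have e2 : 0 ≤ p * (p - 6) ^ 2 * (p - e) := by
            have : 0 ≤ p - e := by linarith
            positivity
          have e3 : 0 ≤ (p - 4) * (7 - p) * (p ^ 2 - 5 * p + 20) := by
            have h1 : 0 ≤ p - 4 := by linarith
            have h2 : 0 ≤ 7 - p := by linarith
            have h3 : 0 ≤ p ^ 2 - 5 * p + 20 := by nlinarith
            positivity
          have e4 : 0 ≤ p ^ 2 * ((e - 4) * (p - e)) := mul_nonneg hp2.le e1
          linarith
        nlinarith
      exact lt_of_mul_lt_mul_right this hp2.le
    rcases hf.eq_or_lt with h0 | h0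
    · rw [← h0]; have : 0 < z ^ 2 := by positivity
      nlinarith [mul_pos hp0 this]
    · have : (e - 4) * W < (e - 4) * (5 * p * z) := mul_lt_mul_of_pos_left h1 h0
      nlinarith [mul_nonneg hp0.le (sq_nonneg (e - 4 - z))]
  · push Not at h7
    have h1 : W ≤ 5 * p / 4 * (e - 4 + 2 * z) := by
      have : W * p ^ 2 ≤ 5 * p / 4 * (e - 4 + 2 * z) * p ^ 2 := by
        have : 5 * p / 4 * (e - 4 + 2 * z) * p ^ 2 =
          5 * p / 4 * ((e - 4) * p ^ 2 + 2 * (4 * e * p - 27 * p + 108)) := by rw [← hzp]; ring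
        rw [this, hWp]
        have key : 0 ≤ (5 / 4 * p * e - e ^ 2 + 6 * e - 5 * p + 1 / 2) * p ^ 2 + 270 * p
            - 36 * e * p - 972 := by
          have e1 : 0 ≤ (e - 4) * (p - e) := mul_nonneg hf (by linarith)
          have e4 : 0 ≤ p ^ 2 * ((e - 4) * (p - e)) := mul_nonneg hp2.le e1
          rcases le_total 0 (p ^ 2 / 4 + 2 * p - 36) with hc | hc
          · have e2 : 0 ≤ p * (p ^ 2 / 4 + 2 * p - 36) * (e - 4) :=
              mul_nonneg (mul_nonneg hp0.le hc) hf
            have e3 : 0 ≤ (p - 7) ^ 2 := sq_nonneg _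
            linarith
          · have e2 : 0 ≤ p * (-(p ^ 2 / 4 + 2 * p - 36)) * (p - e) :=
              mul_nonneg (mul_nonneg hp0.le (by linarith)) (by linarith)
            obtain ⟨u, hu⟩ : ∃ u, p = 7 + u := ⟨p - 7, by ring⟩
            have hu0 : 0 ≤ u := by linarith
            have e3 : 0 ≤ p ^ 4 / 4 + p ^ 3 - 71 / 2 * p ^ 2 + 270 * p - 972 := by
              have : p ^ 4 / 4 + p ^ 3 - 71 / 2 * p ^ 2 + 270 * p - 972 =
                u ^ 4 / 4 + 8 * u ^ 3 + 59 * u ^ 2 + 263 * u + (2401/4 + 343 - 71/2*49 + 1890 - 972) := by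
                rw [hu]; ring
              rw [this]; positivity
            linarith
        nlinarith
      exact le_of_mul_le_mul_right this hp2
    have : (e - 4) * W ≤ (e - 4) * (5 * p / 4 * (e - 4 + 2 * z)) := mul_le_mul_of_nonneg_left h1 hf
    have hz2 : 0 < 5 * p / 4 * z ^ 2 := by positivity
    nlinarith

lemma key_final (A δ t e s w : ℝ) (hA : 0 < A) (hδ : 0 < δ) (hδ1 : δ ≤ 1) (ht : 0 < t)
    (hcub : A ^ 2 * δ * t ^ 3 ≤ 27) (he : e = A * t * (δ - (1 - δ) * t)) (he4 : 4 ≤ e)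
    (hs : s = A * (δ - (2 - δ) * t) + 4)
    (hw : w = A * (e + 2) ^ 2 - 144 - 36 * A * (1 + δ) + 36 * A * (2 - δ) * t) :
    4 * (e - 4) * w < 135 * s ^ 2 := by
  obtain ⟨p, hp⟩ : ∃ p, p = A * t * δ := ⟨_, rfl⟩
  obtain ⟨τ, hτ⟩ : ∃ τ, τ = t / δ := ⟨_, rfl⟩
  have hp0 : 0 < p := by rw [hp]; positivity
  have hτ0 : 0 < τ := by rw [hτ]; positivity
  have htt : t = δ * τ := by rw [hτ]; field_simp
  have hpA : p = A * δ ^ 2 * τ := by rw [hp, htt]; ring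
  have hτp : τ * p ^ 2 ≤ 27 := by
    have : τ * p ^ 2 = A ^ 2 * δ * t ^ 3 := by rw [hpA, htt]; ring
    linarith
  have hep : e = p * (1 - (1 - δ) * τ) := by rw [he, hpA, htt]; ring
  have hple : e ≤ p := by
    have : 0 ≤ p * ((1 - δ) * τ) := by
      have : 0 ≤ 1 - δ := by linarith
      positivity
    nlinarith
  have hlow : p * p - 27 ≤ e * p := by
    have : 0 ≤ p ^ 2 * (δ * τ) := by positivity
    nlinarith
  have hp4 : 4 ≤ p := le_trans he4 hple
  obtain ⟨hpos, hkey⟩ := key_pe p e he4 hple hlow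
  set z := 4 * e / p - 27 / p + 108 / p ^ 2 with hz
  set Wm := e ^ 2 + 4 * e - 68 + 36 * e / p + 972 / p ^ 2 with hWm
  have hτ27 : τ ≤ 27 / p ^ 2 := by rw [le_div_iff₀ (by positivity)]; exact hτp
  -- s
  have hsB : s * (δ * τ) = p * (1 - τ * (2 - δ)) + 4 * δ * τ := by rw [hs, hpA, htt]; ring
  have hs1 : e - 4 + z ≤ s * (δ * τ) := by
    have : s * (δ * τ) - (e - 4 + z) = (p - 4) * (27 / p ^ 2 - τ) := by
      rw [hsB, hz, hep]; field_simp; ring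
    have h2 : 0 ≤ (p - 4) * (27 / p ^ 2 - τ) := mul_nonneg (by linarith) (by linarith)
    linarith
  have hw1 : w * (δ ^ 2 * τ) ≤ p * Wm := by
    have h1 : p * Wm - w * (δ ^ 2 * τ) =
        144 * (δ ^ 2 * τ) + 36 * p * (27 / p ^ 2 - τ) + 36 * (δ * e) := by
      have h2 : p * Wm = p * (e + 2) ^ 2 - 72 * p + 36 * e + p * (972 / p ^ 2) := by
        rw [hWm]; field_simp; ring
      have h3 : w * (δ ^ 2 * τ) = p * ((e + 2) ^ 2 - 36 * (1 + δ) + 36 * (2 - δ) * (δ * τ))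
        - 144 * (δ ^ 2 * τ) := by rw [hw, hpA, htt]; ring
      rw [h2, h3]
      linear_combination 36 * (1 - δ) * hep
    have h5 : 0 ≤ δ ^ 2 * τ := by positivity
    have h6 : 0 ≤ δ * e := mul_nonneg hδ.le (by linarith)
    have h7 : 0 ≤ p * (27 / p ^ 2 - τ) := mul_nonneg hp0.le (by linarith)
    linarith
  by_contra hcon
  push Not at hcon
  have hdt : 0 < δ * τ := by positivity
  have hs2 : (e - 4 + z) ^ 2 ≤ s ^ 2 * (δ * τ) ^ 2 := by
    rw [← mul_pow]; exact pow_le_pow_left₀ hpos.le hs1 2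
  have h1 : 135 * (s ^ 2 * (δ * τ) ^ 2) ≤ 4 * (e - 4) * τ * (w * (δ ^ 2 * τ)) := by
    have := mul_le_mul_of_nonneg_right hcon (sq_nonneg (δ * τ))
    linarith
  have h2 : 4 * (e - 4) * τ * (w * (δ ^ 2 * τ)) ≤ 4 * (e - 4) * τ * (p * Wm) :=
    mul_le_mul_of_nonneg_left hw1 (by have : 0 ≤ e - 4 := by linarith
                                      positivity)
  have hpos2 : 0 < (e - 4 + z) ^ 2 := by positivity
  have h23 : 135 * (e - 4 + z) ^ 2 ≤ (e - 4) * Wm * (4 * τ * p) := by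
    have : 4 * (e - 4) * τ * (p * Wm) = (e - 4) * Wm * (4 * τ * p) := by ring
    linarith
  have h3 : 0 < (e - 4) * Wm * (4 * τ * p) := by linarith
  have h4 : 0 < (e - 4) * Wm := pos_of_mul_pos_left h3 (by positivity)
  have h5 : (e - 4) * Wm * (4 * (τ * p ^ 2)) ≤ (e - 4) * Wm * 108 :=
    mul_le_mul_of_nonneg_left (by linarith) h4.le
  have h6 : 135 * (e - 4 + z) ^ 2 * p ≤ (e - 4) * Wm * (4 * τ * p) * p :=
    mul_le_mul_of_nonneg_right h23 hp0.le
  have h7 : (e - 4) * Wm * (4 * τ * p) * p = (e - 4) * Wm * (4 * (τ * p ^ 2)) := by ring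
  linarith

open Polynomial in
/-- Coefficient of `x^i` in the Laguerre polynomial. -/
noncomputable def lagCoeff (k : ℕ) (α : ℝ) (i : ℕ) : ℝ :=
  ((-1 : ℝ) ^ i / (Nat.factorial i)) *
      ((∏ j ∈ Finset.range (k - i), (α + (i : ℝ) + (j : ℝ) + 1)) /
        (Nat.factorial (k - i)))

open Polynomial in
/-- The Laguerre polynomial as a `Polynomial`. -/
noncomputable def lagPoly (k : ℕ) (α : ℝ) : ℝ[X] :=
  ∑ i ∈ Finset.range (k + 1), monomial i (lagCoeff k α i)

open Polynomial

lemma lagPoly_eval (k : ℕ) (α x : ℝ) : (lagPoly k α).eval x = laguerre k α x := by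
  simp [lagPoly, laguerre, lagCoeff, eval_finsetSum]

lemma lagPoly_coeff (k : ℕ) (α : ℝ) (n : ℕ) :
    (lagPoly k α).coeff n = if n ≤ k then lagCoeff k α n else 0 := by
  simp [lagPoly, coeff_monomial]

lemma lagCoeff_rec (k : ℕ) (α : ℝ) (i : ℕ) (hi : i < k) :
    ((i : ℝ) + 1) * (i + 1 + α) * lagCoeff k α (i + 1) + ((k : ℝ) - i) * lagCoeff k α i = 0 := by
  obtain ⟨m, rfl⟩ : ∃ m, k = i + 1 + m := ⟨k - (i + 1), by omega⟩
  have h1 : i + 1 + m - (i + 1) = m := by omega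
  have h2 : i + 1 + m - i = m + 1 := by omega
  unfold lagCoeff
  rw [h1, h2, Finset.prod_range_succ', Nat.factorial_succ, Nat.factorial_succ]
  have h3 : ∏ j ∈ Finset.range m, (α + (i : ℝ) + ((j + 1 : ℕ) : ℝ) + 1) =
      ∏ j ∈ Finset.range m, (α + ((i + 1 : ℕ) : ℝ) + (j : ℝ) + 1) := by
    apply Finset.prod_congr rfl
    intro j _
    push_cast; ring
  rw [h3]
  have hf1 : (Nat.factorial i : ℝ) ≠ 0 := by positivity
  have hf2 : (Nat.factorial m : ℝ) ≠ 0 := by positivity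
  have h4 : (i : ℝ) + 1 ≠ 0 := by positivity
  have h5 : (m : ℝ) + 1 ≠ 0 := by positivity
  push_cast
  field_simp
  ring

lemma lagPoly_ode (k : ℕ) (α : ℝ) :
    X * derivative (derivative (lagPoly k α)) + (C (α + 1) - X) * derivative (lagPoly k α)
      + C (k : ℝ) * lagPoly k α = 0 := by
  ext n
  rw [sub_mul]
  simp only [coeff_add, coeff_sub, coeff_C_mul, coeff_zero]
  have key : ((n : ℝ) + 1) * (n + 1 + α) * (lagPoly k α).coeff (n + 1)
      + ((k : ℝ) - n) * (lagPoly k α).coeff n = 0 := by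
    rw [lagPoly_coeff, lagPoly_coeff]
    rcases lt_trichotomy n k with h | h | h
    · rw [if_pos (by omega), if_pos (by omega)]; exact lagCoeff_rec k α n h
    · subst h; simp
    · rw [if_neg (by omega), if_neg (by omega)]; simp
  cases n with
  | zero =>
    simp [coeff_derivative] at key ⊢
    linarith
  | succ n =>
    simp only [coeff_X_mul, coeff_derivative] at key ⊢
    push_cast at key ⊢
    linarith

lemma lagPoly_deriv (k : ℕ) (α : ℝ) :
    derivative (lagPoly (k + 1) α) = - lagPoly k (α + 1) := by
  ext n
  rw [coeff_derivative, coeff_neg, lagPoly_coeff, lagPoly_coeff]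
  by_cases h : n ≤ k
  · rw [if_pos (by omega), if_pos h]
    unfold lagCoeff
    have h1 : k + 1 - (n + 1) = k - n := by omega
    rw [h1, Nat.factorial_succ]
    have h3 : ∏ j ∈ Finset.range (k - n), (α + ((n + 1 : ℕ) : ℝ) + (j : ℝ) + 1) =
        ∏ j ∈ Finset.range (k - n), (α + 1 + (n : ℝ) + (j : ℝ) + 1) := by
      apply Finset.prod_congr rfl
      intro j _
      push_cast; ring
    rw [h3]
    have hf1 : (Nat.factorial n : ℝ) ≠ 0 := by positivity
    have h4 : (n : ℝ) + 1 ≠ 0 := by positivity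
    push_cast
    field_simp
    ring
  · rw [if_neg (by omega), if_neg h]; simp

lemma lagPoly_natDegree (k : ℕ) (α : ℝ) : (lagPoly k α).natDegree = k := by
  apply natDegree_eq_of_le_of_coeff_ne_zero
  · rw [natDegree_le_iff_coeff_eq_zero]
    intro N hN
    rw [lagPoly_coeff, if_neg (by omega)]
  · rw [lagPoly_coeff, if_pos le_rfl]
    simp [lagCoeff, Nat.factorial_ne_zero]

lemma lagPoly_ne_zero (k : ℕ) (α : ℝ) : lagPoly k α ≠ 0 := by
  intro h
  have : (lagPoly k α).coeff k ≠ 0 := by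
    rw [lagPoly_coeff, if_pos le_rfl]
    simp [lagCoeff, Nat.factorial_ne_zero]
  simp [h] at this

lemma lagPoly_pos (k : ℕ) (α : ℝ) (hα : -1 < α) (x : ℝ) (hx : x ≤ 0) :
    0 < (lagPoly k α).eval x := by
  rw [lagPoly_eval, laguerre]
  have hprod : ∀ i : ℕ, 0 < ∏ j ∈ Finset.range (k - i), (α + (i : ℝ) + (j : ℝ) + 1) := by
    intro i
    apply Finset.prod_pos
    intro j _
    have h1 : (0 : ℝ) ≤ i := by positivity
    have h2 : (0 : ℝ) ≤ j := by positivity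
    linarith
  have hterm : ∀ i : ℕ, ((-1 : ℝ) ^ i / (Nat.factorial i)) *
      ((∏ j ∈ Finset.range (k - i), (α + (i : ℝ) + (j : ℝ) + 1)) /
        (Nat.factorial (k - i))) * x ^ i = ((-x) ^ i / (Nat.factorial i)) *
      ((∏ j ∈ Finset.range (k - i), (α + (i : ℝ) + (j : ℝ) + 1)) /
        (Nat.factorial (k - i))) := by
    intro i
    rw [neg_pow x i]; ring
  apply Finset.sum_pos'
  · intro i _
    rw [hterm]
    have := hprod i
    have h0 : 0 ≤ -x := by linarith
    positivity
  · refine ⟨0, by simp, ?_⟩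
    have := hprod 0
    rw [hterm]
    simp only [pow_zero]
    positivity

lemma ode_iter (f : ℝ[X]) (A κ : ℝ)
    (h : X * derivative (derivative f) + (C A - X) * derivative f + C κ * f = 0) (n : ℕ) :
    X * derivative^[n + 2] f + (C (n + A) - X) * derivative^[n + 1] f
      + C (κ - n) * derivative^[n] f = 0 := by
  induction n with
  | zero => simpa using h
  | succ n ih =>
    have := congrArg derivative ih
    simp only [derivative_add, derivative_mul, derivative_sub, derivative_X, derivative_C,
      derivative_zero, ← Function.iterate_succ_apply' derivative] at this
    simp only [map_add, map_sub, map_natCast, map_one, Nat.cast_add, Nat.cast_one,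
      Nat.succ_eq_add_one] at this ⊢
    have e1 : n + 1 + 2 = n + 2 + 1 := by ring
    have e2 : n + 1 + 1 = n + 2 := by ring
    rw [e1, e2]
    rw [e2] at this
    linear_combination this

lemma ode_simple (f : ℝ[X]) (A κ : ℝ) (hf : f ≠ 0)
    (h : X * derivative (derivative f) + (C A - X) * derivative f + C κ * f = 0)
    (x : ℝ) (hx : x ≠ 0) (h0 : f.eval x = 0) : (derivative f).eval x ≠ 0 := by
  intro h1
  apply hf
  have hall : ∀ n, (derivative^[n] f).eval x = 0 ∧ (derivative^[n + 1] f).eval x = 0 := by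
    intro n
    induction n with
    | zero => simpa using ⟨h0, h1⟩
    | succ n ih =>
      refine ⟨ih.2, ?_⟩
      have := congrArg (eval x) (ode_iter f A κ h n)
      simp only [eval_add, eval_mul, eval_sub, eval_X, eval_C, ih.1, ih.2, eval_zero, mul_zero,
        add_zero] at this
      rcases mul_eq_zero.mp this with h | h
      · exact absurd h hx
      · exact h
  apply eq_zero_of_hasseDeriv_eq_zero f x
  intro n
  have h2 := congrFun (factorial_smul_hasseDeriv (R := ℝ) n) f
  have h3 := congrArg (eval x) h2
  rw [(hall n).1] at h3
  simp only [LinearMap.smul_apply, Pi.smul_apply, eval_smul, nsmul_eq_mul] at h3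
  simpa [Nat.factorial_ne_zero] using h3

lemma ode_rolle (f : ℝ[X]) (A κ : ℝ) (hA : 0 < A) (hκ : κ ≠ 0)
    (h : X * derivative (derivative f) + (C A - X) * derivative f + C κ * f = 0)
    (a b : ℝ) (ha : 0 ≤ a) (hab : a < b) (ha' : a = 0 ∨ (derivative f).eval a = 0)
    (hb : (derivative f).eval b = 0) : ∃ z, a < z ∧ z < b ∧ f.eval z = 0 := by
  set q := derivative f with hq
  have hcont : Continuous fun x : ℝ => x ^ A * Real.exp (-x) * q.eval x := by
    have : Continuous fun x : ℝ => x ^ A := continuous_id.rpow_const (fun x => Or.inr hA.le)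
    have h2 := q.continuous
    fun_prop
  have hderiv : ∀ x ∈ Set.Ioo a b, HasDerivAt (fun x : ℝ => x ^ A * Real.exp (-x) * q.eval x)
      ((A * x ^ (A - 1) * Real.exp (-x) + x ^ A * (Real.exp (-x) * (-1))) * q.eval x
        + x ^ A * Real.exp (-x) * (derivative q).eval x) x := by
    intro x hx
    have hx0 : 0 < x := lt_of_le_of_lt ha hx.1
    have d1 : HasDerivAt (fun x : ℝ => x ^ A) (A * x ^ (A - 1)) x :=
      Real.hasDerivAt_rpow_const (Or.inl hx0.ne')
    have d2 : HasDerivAt (fun x : ℝ => Real.exp (-x)) (Real.exp (-x) * (-1)) x :=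
      (hasDerivAt_neg x).exp
    exact (d1.mul d2).mul (q.hasDerivAt x)
  have hend : a ^ A * Real.exp (-a) * q.eval a = b ^ A * Real.exp (-b) * q.eval b := by
    rw [hb]
    rcases ha' with h0 | h0
    · rw [h0, Real.zero_rpow hA.ne']; simp
    · rw [h0]; simp
  obtain ⟨c, hc, hc0⟩ := exists_hasDerivAt_eq_zero hab hcont.continuousOn hend hderiv
  refine ⟨c, hc.1, hc.2, ?_⟩
  have hcpos : 0 < c := lt_of_le_of_lt ha hc.1
  have e1 : c ^ A = c * c ^ (A - 1) := by
    rw [Real.rpow_sub_one hcpos.ne']; field_simp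
  have hode := congrArg (eval c) h
  simp only [eval_add, eval_mul, eval_sub, eval_X, eval_C, eval_zero] at hode
  rw [e1] at hc0
  have h3 : (c ^ (A - 1) * Real.exp (-c)) * (κ * f.eval c) = 0 := by
    linear_combination (c ^ (A - 1) * Real.exp (-c)) * hode - hc0
  have h4 : c ^ (A - 1) * Real.exp (-c) ≠ 0 :=
    (mul_pos (Real.rpow_pos_of_pos hcpos _) (Real.exp_pos _)).ne'
  rcases mul_eq_zero.mp h3 with h5 | h5
  · exact absurd h5 h4
  · exact (mul_eq_zero.mp h5).resolve_left hκ

lemma splits_of_card (f : ℝ[X]) (n : ℕ) (hn : f.natDegree = n + 1) (hc : n ≤ f.roots.card) :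
    f.Splits := by
  obtain ⟨q, h1, h2, h3⟩ := exists_prod_multiset_X_sub_C_mul f
  have hq : q.natDegree ≤ 1 := by omega
  have hs : q.Splits := Splits.of_natDegree_le_one hq
  have h4 := splits_iff_card_roots.mp hs
  rw [h3] at h4
  rw [splits_iff_card_roots]
  simp at h4
  omega

lemma lagPoly_root_pos (k : ℕ) (α : ℝ) (hα : -1 < α) (x : ℝ) (hx : (lagPoly k α).eval x = 0) :
    0 < x := by
  by_contra hc
  have := lagPoly_pos k α hα x (by linarith)
  linarith

lemma lagPoly_splits (k : ℕ) : ∀ α : ℝ, -1 < α → (lagPoly k α).Splits := by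
  induction k with
  | zero =>
    intro α _
    apply Splits.of_natDegree_le_one
    rw [lagPoly_natDegree]; omega
  | succ k ih =>
    intro α hα
    have hα1 : -1 < α + 1 := by linarith
    have hs := ih (α + 1) hα1
    set q := lagPoly k (α + 1) with hq
    set f := lagPoly (k + 1) α with hf
    have hq0 : q ≠ 0 := lagPoly_ne_zero _ _
    have hf0 : f ≠ 0 := lagPoly_ne_zero _ _
    have hder : derivative f = -q := lagPoly_deriv k α
    have hcard := splits_iff_card_roots.mp hs
    rw [hq, lagPoly_natDegree, ← hq] at hcard
    have hnodup : q.roots.Nodup := by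
      rw [Multiset.nodup_iff_count_le_one]
      intro x
      rw [count_roots]
      by_contra hc
      push Not at hc
      rw [one_lt_rootMultiplicity_iff_isRoot hq0] at hc
      have hxp := lagPoly_root_pos k (α + 1) hα1 x hc.1
      exact ode_simple q _ _ hq0 (lagPoly_ode k (α + 1)) x hxp.ne' hc.1 hc.2
    have hroot : ∀ y, y ∈ q.roots.toFinset → q.eval y = 0 := by
      intro y hy
      rw [Multiset.mem_toFinset, mem_roots hq0] at hy
      exact hy
    have h0 : (0 : ℝ) ∉ q.roots.toFinset := by
      intro hmem
      have := lagPoly_root_pos k (α + 1) hα1 0 (hroot 0 hmem)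
      linarith
    have hinter : (insert 0 q.roots.toFinset).card ≤ (f.roots.toFinset).card + 1 := by
      apply Finset.card_le_of_interleaved
      intro x hx y hy hxy _
      have hnn : ∀ w ∈ insert 0 q.roots.toFinset, (0 : ℝ) ≤ w := by
        intro w hw
        rcases Finset.mem_insert.mp hw with h | h
        · rw [h]
        · exact (lagPoly_root_pos k (α + 1) hα1 w (hroot w h)).le
      have hx0 := hnn x hx
      have hyr : q.eval y = 0 := by
        rcases Finset.mem_insert.mp hy with h | h
        · rw [h] at hxy; linarith
        · exact hroot y h
      have hxr : x = 0 ∨ (derivative f).eval x = 0 := by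
        rcases Finset.mem_insert.mp hx with h | h
        · exact Or.inl h
        · right; rw [hder, eval_neg, hroot x h, neg_zero]
      obtain ⟨z, h1, h2, h3⟩ := ode_rolle f (α + 1) ((k + 1 : ℕ) : ℝ) (by linarith)
        (by positivity) (lagPoly_ode (k + 1) α) x y hx0 hxy hxr
        (by rw [hder, eval_neg, hyr, neg_zero])
      refine ⟨z, ?_, h1, h2⟩
      rw [Multiset.mem_toFinset, mem_roots hf0]
      exact h3
    rw [Finset.card_insert_of_notMem h0, Multiset.toFinset_card_of_nodup hnodup, hcard] at hinter
    have hle := Multiset.toFinset_card_le f.roots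
    exact splits_of_card f k (lagPoly_natDegree _ _) (by omega)

lemma prod_power_sums (c x : ℝ) (hc : c ≠ 0) (s : Multiset ℝ) (hx : x ∉ s) :
    ∃ g : ℝ[X], g = C c * (s.map (X - C ·)).prod ∧ ∃ P1 P2 P3 P4 : ℝ, g.eval x ≠ 0 ∧
      (derivative^[1] g).eval x = g.eval x * P1 ∧
      (derivative^[2] g).eval x = g.eval x * (P1 ^ 2 - P2) ∧
      (derivative^[3] g).eval x = g.eval x * (P1 ^ 3 - 3 * P1 * P2 + 2 * P3) ∧
      (derivative^[4] g).eval x = g.eval x *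
        (P1 ^ 4 - 6 * P1 ^ 2 * P2 + 3 * P2 ^ 2 + 8 * P1 * P3 - 6 * P4) ∧
      0 ≤ P2 ∧ ∀ l : ℝ, 0 ≤ P2 * (l * l) + (-2 * P3) * l + P4 := by
  induction s using Multiset.induction_on with
  | empty =>
    refine ⟨C c, by simp, 0, 0, 0, 0, by simpa using hc, ?_⟩
    simp
  | cons a s ih =>
    rw [Multiset.mem_cons, not_or] at hx
    obtain ⟨g, hg, P1, P2, P3, P4, h0, h1, h2, h3, h4, hP2, hl⟩ := ih hx.2
    have hd : x - a ≠ 0 := sub_ne_zero.mpr hx.1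
    obtain ⟨u, hu⟩ : ∃ u, u = (x - a)⁻¹ := ⟨_, rfl⟩
    have hdu : (x - a) * u = 1 := by rw [hu]; field_simp
    refine ⟨(X - C a) * g, ?_, P1 + u, P2 + u ^ 2, P3 + u ^ 3, P4 + u ^ 4, ?_⟩
    · rw [hg, Multiset.map_cons, Multiset.prod_cons]; ring
    simp only [Function.iterate_succ_apply', Function.iterate_zero, id_eq] at h1 h2 h3 h4
    simp only [Function.iterate_succ_apply', Function.iterate_zero, id_eq, derivative_mul,
      derivative_sub, derivative_X, derivative_C, sub_zero, one_mul, derivative_add,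
      eval_add, eval_mul, eval_sub, eval_X, eval_C, h1, h2, h3, h4]
    refine ⟨mul_ne_zero hd h0, ?_, ?_, ?_, ?_, by positivity, ?_⟩
    · linear_combination (-eval x g) * hdu
    · linear_combination (-2 * eval x g * P1) * hdu
    · linear_combination (-3 * eval x g * (P1 ^ 2 - P2)) * hdu
    · linear_combination (-4 * eval x g * (P1 ^ 3 - 3 * P1 * P2 + 2 * P3)) * hdu
    · intro l
      have := hl l
      have h5 : 0 ≤ (u * l - u ^ 2) ^ 2 := sq_nonneg _
      linarith

lemma root_relations (k : ℕ) (α : ℝ) (hα : -1 < α) (x : ℝ) (hx : (lagPoly k α).eval x = 0) :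
    ∃ P1 P2 P3 P4 : ℝ, 0 ≤ P2 ∧ P3 ^ 2 ≤ P2 * P4 ∧
      2 * x * P1 + (α + 1 - x) = 0 ∧
      3 * x * (P1 ^ 2 - P2) + 2 * (1 + (α + 1) - x) * P1 + ((k : ℝ) - 1) = 0 ∧
      4 * x * (P1 ^ 3 - 3 * P1 * P2 + 2 * P3) + 3 * (2 + (α + 1) - x) * (P1 ^ 2 - P2)
        + 2 * ((k : ℝ) - 2) * P1 = 0 ∧
      5 * x * (P1 ^ 4 - 6 * P1 ^ 2 * P2 + 3 * P2 ^ 2 + 8 * P1 * P3 - 6 * P4)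
        + 4 * (3 + (α + 1) - x) * (P1 ^ 3 - 3 * P1 * P2 + 2 * P3)
        + 3 * ((k : ℝ) - 3) * (P1 ^ 2 - P2) = 0 := by
  have hf0 := lagPoly_ne_zero k α
  have hsp := (lagPoly_splits k α hα).eq_prod_roots
  have hxpos := lagPoly_root_pos k α hα x hx
  have hode := lagPoly_ode k α
  have hsimple := ode_simple _ _ _ hf0 hode x hxpos.ne' hx
  set f := lagPoly k α with hf
  have hmem : x ∈ f.roots := (mem_roots hf0).mpr hx
  obtain ⟨s, hs⟩ := Multiset.exists_cons_of_mem hmem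
  rw [hs, Multiset.map_cons, Multiset.prod_cons] at hsp
  have hxs : x ∉ s := by
    intro hxs
    have h1 : 1 < f.rootMultiplicity x := by
      rw [← count_roots, hs, Multiset.count_cons_self]
      have := Multiset.one_le_count_iff_mem.mpr hxs
      omega
    rw [one_lt_rootMultiplicity_iff_isRoot hf0] at h1
    exact hsimple h1.2
  obtain ⟨g, hg, P1, P2, P3, P4, h0, h1, h2, h3, h4, hP2, hl⟩ :=
    prod_power_sums f.leadingCoeff x (leadingCoeff_ne_zero.mpr hf0) s hxs
  have hfg : f = (X - C x) * g := by rw [hg]; linear_combination hsp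
  refine ⟨P1, P2, P3, P4, hP2, ?_, ?_⟩
  · have := discrim_le_zero hl
    unfold discrim at this
    linarith
  have o0 := congrArg (eval x) (ode_iter f _ _ hode 0)
  have o1 := congrArg (eval x) (ode_iter f _ _ hode 1)
  have o2 := congrArg (eval x) (ode_iter f _ _ hode 2)
  have o3 := congrArg (eval x) (ode_iter f _ _ hode 3)
  clear_value f
  subst hfg
  simp only [Function.iterate_succ_apply', Function.iterate_zero, id_eq] at h1 h2 h3 h4
  simp only [Function.iterate_succ_apply', Function.iterate_zero, id_eq, derivative_mul,
      derivative_sub, derivative_X, derivative_C, sub_zero, one_mul, derivative_add, sub_self,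
      zero_mul, zero_add, add_zero, eval_zero, Nat.cast_zero, Nat.cast_one, Nat.cast_ofNat,
      mul_zero,
      eval_add, eval_mul, eval_sub, eval_X, eval_C, h1, h2, h3, h4] at o0 o1 o2 o3
  refine ⟨mul_left_cancel₀ h0 ?_, mul_left_cancel₀ h0 ?_, mul_left_cancel₀ h0 ?_,
    mul_left_cancel₀ h0 ?_⟩
  · linear_combination o0
  · linear_combination o1
  · linear_combination o2
  · linear_combination o3

lemma root_algebra (k A x P1 P2 P3 P4 : ℝ) (hx : 0 < x)
    (h0 : 2 * x * P1 + (A - x) = 0)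
    (h1 : 3 * x * (P1 ^ 2 - P2) + 2 * (1 + A - x) * P1 + (k - 1) = 0)
    (h2 : 4 * x * (P1 ^ 3 - 3 * P1 * P2 + 2 * P3) + 3 * (2 + A - x) * (P1 ^ 2 - P2)
        + 2 * (k - 2) * P1 = 0)
    (h3 : 5 * x * (P1 ^ 4 - 6 * P1 ^ 2 * P2 + 3 * P2 ^ 2 + 8 * P1 * P3 - 6 * P4)
        + 4 * (3 + A - x) * (P1 ^ 3 - 3 * P1 * P2 + 2 * P3)
        + 3 * (k - 3) * (P1 ^ 2 - P2) = 0) :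
    12 * (x ^ 2 * P2) = -x ^ 2 + 2 * (2 * k + A) * x - A ^ 2 - 4 * A ∧
    8 * (x ^ 3 * P3) = (2 * k + A) * x - A ^ 2 - 2 * A ∧
    720 * (x ^ 4 * P4) = (-x ^ 2 + 2 * (2 * k + A) * x - A ^ 2 + 2 * A) ^ 2 - 360 * A
      + 72 * (2 * k + A) * x + 108 * A * (2 - A) := by
  obtain ⟨m, hm⟩ : ∃ m, m = x * P1 := ⟨_, rfl⟩
  obtain ⟨s2, hs2⟩ : ∃ s, s = x ^ 2 * P2 := ⟨_, rfl⟩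
  obtain ⟨s3, hs3⟩ : ∃ s, s = x ^ 3 * P3 := ⟨_, rfl⟩
  obtain ⟨s4, hs4⟩ : ∃ s, s = x ^ 4 * P4 := ⟨_, rfl⟩
  have g0 : m = (x - A) / 2 := by rw [hm]; linear_combination h0 / 2
  have g1 : 3 * (m ^ 2 - s2) + 2 * (1 + A - x) * m + (k - 1) * x = 0 := by
    rw [hm, hs2]; linear_combination x * h1
  have g2 : 4 * (m ^ 3 - 3 * m * s2 + 2 * s3) + 3 * (2 + A - x) * (m ^ 2 - s2)
        + 2 * (k - 2) * x * m = 0 := by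
    rw [hm, hs2, hs3]; linear_combination x ^ 2 * h2
  have g3 : 5 * (m ^ 4 - 6 * m ^ 2 * s2 + 3 * s2 ^ 2 + 8 * m * s3 - 6 * s4)
        + 4 * (3 + A - x) * (m ^ 3 - 3 * m * s2 + 2 * s3)
        + 3 * (k - 3) * x * (m ^ 2 - s2) = 0 := by
    rw [hm, hs2, hs3, hs4]; linear_combination x ^ 3 * h3
  rw [← hs2, ← hs3, ← hs4]
  clear hm hs2 hs3 hs4
  have e2 : s2 = (-x ^ 2 + 2 * (2 * k + A) * x - A ^ 2 - 4 * A) / 12 := by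
    rw [g0] at g1; linear_combination (-1/3) * g1
  have e3 : s3 = ((2 * k + A) * x - A ^ 2 - 2 * A) / 8 := by
    rw [g0, e2] at g2; linear_combination (1/8) * g2
  have e4 : s4 = ((-x ^ 2 + 2 * (2 * k + A) * x - A ^ 2 + 2 * A) ^ 2 - 360 * A
      + 72 * (2 * k + A) * x + 108 * A * (2 - A)) / 720 := by
    rw [g0, e2, e3] at g3; linear_combination (-1/30) * g3
  refine ⟨by rw [e2]; ring, by rw [e3]; ring, by rw [e4]; ring⟩

lemma uv_contra (U V x s2 s3 s4 : ℝ) (hV : 0 < V) (hUV : V < U) (hx : 0 < x)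
    (hs2 : 12 * s2 = (U ^ 2 - x) * (x - V ^ 2) - 4 * (U * V))
    (hs3 : 8 * s3 = (U ^ 2 + V ^ 2) / 2 * x - (U * V) ^ 2 - 2 * (U * V))
    (hs4 : 720 * s4 = ((U ^ 2 - x) * (x - V ^ 2) + 2 * (U * V)) ^ 2 - 360 * (U * V)
      + 36 * (U ^ 2 + V ^ 2) * x + 108 * (U * V) * (2 - U * V))
    (h2 : 0 ≤ s2) (hc : s3 ^ 2 ≤ s2 * s4)
    (hcub : (x - V ^ 2) ^ 3 * (U ^ 2 - V ^ 2) ≤ 27 * V ^ 4) : False := by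
  have hU : 0 < U := hV.trans hUV
  have hA : 0 < U * V := by positivity
  have hsq : V ^ 2 < U ^ 2 := by nlinarith
  have hD : 0 < (U ^ 2 - x) * (x - V ^ 2) := by linarith
  have hxV : 0 < x - V ^ 2 := by
    by_contra hcon
    have h3 : 0 < U ^ 2 - x := by linarith
    nlinarith
  have key := key_final (U * V) (1 - V ^ 2 / U ^ 2) ((x - V ^ 2) / V ^ 2)
    ((U ^ 2 - x) * (x - V ^ 2) / (U * V)) (-16 * s3 / (U * V)) (720 * s4 / (U * V)) hA
    (by rw [sub_pos, div_lt_one (by positivity)]; exact hsq)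
    (by have : 0 ≤ V ^ 2 / U ^ 2 := by positivity
        linarith)
    (by positivity)
    (by
      have : (U * V) ^ 2 * (1 - V ^ 2 / U ^ 2) * ((x - V ^ 2) / V ^ 2) ^ 3
        = (x - V ^ 2) ^ 3 * (U ^ 2 - V ^ 2) / V ^ 4 := by field_simp
      rw [this, div_le_iff₀ (by positivity)]; exact hcub)
    (by field_simp; ring)
    (by rw [le_div_iff₀ hA]; linarith)
    (by
      rw [show -16 * s3 = -2 * (8 * s3) by ring, hs3]; field_simp; ring)
    (by rw [hs4]; field_simp; ring)
  have e1 : (U ^ 2 - x) * (x - V ^ 2) / (U * V) - 4 = 12 * s2 / (U * V) := by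
    rw [hs2]; field_simp
  rw [e1] at key
  have e2 : 4 * (12 * s2 / (U * V)) * (720 * s4 / (U * V)) = 34560 * (s2 * s4) / (U * V) ^ 2 := by
    field_simp; ring
  have e3 : 135 * (-16 * s3 / (U * V)) ^ 2 = 34560 * s3 ^ 2 / (U * V) ^ 2 := by
    field_simp; ring
  rw [e2, e3, div_lt_div_iff_of_pos_right (by positivity)] at key
  linarith

/-- The least zero of `L_k^{(α)}` satisfies `x₁ > V² + 3 V^{4/3} (U² − V²)^{−1/3}`. -/
theorem laguerre_least_zero_gt
    (k : ℕ) (hk : 1 ≤ k) (α : ℝ) (hα : -1 < α)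
    (V U : ℝ) (hV : V = Real.sqrt ((k : ℝ) + α + 1) - Real.sqrt (k : ℝ))
    (hU : U = Real.sqrt ((k : ℝ) + α + 1) + Real.sqrt (k : ℝ))
    (x1 : ℝ) (hroot : laguerre k α x1 = 0)
    (hmin : ∀ y : ℝ, laguerre k α y = 0 → x1 ≤ y) :
    x1 > V ^ 2 + 3 * V ^ ((4 : ℝ) / 3) * (U ^ 2 - V ^ 2) ^ (-(1 : ℝ) / 3) := by
  have hk1 : (1 : ℝ) ≤ k := by exact_mod_cast hk
  have hroot' : (lagPoly k α).eval x1 = 0 := by rw [lagPoly_eval]; exact hroot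
  have hxpos := lagPoly_root_pos k α hα x1 hroot'
  obtain ⟨P1, P2, P3, P4, hP2, hCS, h0, h1, h2, h3⟩ := root_relations k α hα x1 hroot'
  obtain ⟨e2, e3, e4⟩ := root_algebra k (α + 1) x1 P1 P2 P3 P4 hxpos h0 h1 h2 h3
  have hR : Real.sqrt ((k : ℝ) + α + 1) ^ 2 = k + α + 1 := Real.sq_sqrt (by linarith)
  have hK : Real.sqrt (k : ℝ) ^ 2 = k := Real.sq_sqrt (by linarith)
  have hKpos : 0 < Real.sqrt (k : ℝ) := Real.sqrt_pos.mpr (by linarith)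
  have hlt : Real.sqrt (k : ℝ) < Real.sqrt ((k : ℝ) + α + 1) :=
    Real.sqrt_lt_sqrt (by linarith) (by linarith)
  have hVpos : 0 < V := by rw [hV]; linarith
  have hVU : V < U := by rw [hV, hU]; linarith
  have hA : U * V = α + 1 := by rw [hU, hV]; linear_combination hR - hK
  have hN : U ^ 2 + V ^ 2 = 2 * (2 * k + (α + 1)) := by
    rw [hU, hV]; linear_combination 2 * hR + 2 * hK
  have hdiff : 0 < U ^ 2 - V ^ 2 := by nlinarith
  by_contra hcon
  rw [gt_iff_lt, not_lt] at hcon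
  have hA2 : (α + 1) ^ 2 = U ^ 2 * V ^ 2 := by rw [← hA]; ring
  refine uv_contra U V x1 (x1 ^ 2 * P2) (x1 ^ 3 * P3) (x1 ^ 4 * P4) hVpos hVU hxpos
    ?_ ?_ ?_ (by positivity) ?_ ?_
  · rw [e2, hA]; linear_combination (-x1) * hN - hA2
  · rw [e3, hA]; linear_combination (-x1 / 2) * hN
  · have : (U ^ 2 - x1) * (x1 - V ^ 2) = -x1 ^ 2 + 2 * (2 * k + (α + 1)) * x1 - (α + 1) ^ 2 := by
      linear_combination x1 * hN + hA2
    rw [e4, hA, this]; linear_combination (-36 * x1) * hN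
  · have h5 : 0 ≤ x1 ^ 6 := by positivity
    have h6 := mul_le_mul_of_nonneg_left hCS h5
    linarith
  · set y := 3 * V ^ ((4 : ℝ) / 3) * (U ^ 2 - V ^ 2) ^ (-(1 : ℝ) / 3) with hy
    have hy3 : y ^ 3 * (U ^ 2 - V ^ 2) = 27 * V ^ 4 := by
      have a1 : (V ^ ((4 : ℝ) / 3)) ^ 3 = V ^ 4 := by
        rw [← Real.rpow_natCast, ← Real.rpow_mul hVpos.le, ← Real.rpow_natCast]
        norm_num
      have a2 : ((U ^ 2 - V ^ 2) ^ (-(1 : ℝ) / 3)) ^ 3 = (U ^ 2 - V ^ 2)⁻¹ := by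
        rw [← Real.rpow_natCast, ← Real.rpow_mul hdiff.le, ← Real.rpow_neg_one]
        norm_num
      rw [hy, mul_pow, mul_pow, a1, a2]
      field_simp
      norm_num
    rw [← hy3]
    apply mul_le_mul_of_nonneg_right _ hdiff.le
    have hodd : Odd 3 := by decide
    exact hodd.strictMono_pow.monotone (by linarith)
end

section
/- Let α ≥ β > −1 and let x_1 be the least zero of the Jacobi polynomial P_k^{(α,β)}. Then x_1 > A + 3·(1 − A²)^{2/3}·(2R)^{−1/3}, where s = α+β+1, q = α−β, r = 2k+α+β+1, R = √((r²−q²+2s+1)(r²−s²)), and A = −(R + q(s+1))/(r² + 2s + 1). -/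
/-- The Jacobi polynomial `P_k^{(α,β)}` as a real function:
`P_k^{(α,β)}(x) = ∑_{i=0}^{k} [(∏_{j=1}^{k−i}(α+i+j))/(k−i)!] · [(∏_{j=1}^{i}(β+k−i+j))/i!]
  · ((x−1)/2)^i · ((x+1)/2)^{k−i}`. -/
noncomputable def jacobi (k : ℕ) (α β : ℝ) (x : ℝ) : ℝ :=
  ∑ i ∈ Finset.range (k + 1),
    ((∏ j ∈ Finset.range (k - i), (α + (i : ℝ) + (j : ℝ) + 1)) /
      (Nat.factorial (k - i))) *
    ((∏ j ∈ Finset.range i, (β + ((k - i : ℕ) : ℝ) + (j : ℝ) + 1)) /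
      (Nat.factorial i)) *
    ((x - 1) / 2) ^ i * ((x + 1) / 2) ^ (k - i)

open Polynomial

noncomputable def jc (k : ℕ) (α β : ℝ) (i : ℕ) : ℝ :=
  ((∏ j ∈ Finset.range (k - i), (α + (i : ℝ) + (j : ℝ) + 1)) / (Nat.factorial (k - i))) *
    ((∏ j ∈ Finset.range i, (β + ((k - i : ℕ) : ℝ) + (j : ℝ) + 1)) / (Nat.factorial i))

lemma jc_rel1 (n : ℕ) (α β : ℝ) (i : ℕ) (hi : i ≤ n) :
    ((n : ℝ) + 1 - i) * jc (n + 1) α β i = (α + 1 + i) * jc n (α + 1) (β + 1) i := by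
  obtain ⟨m, rfl⟩ := Nat.exists_eq_add_of_le hi
  have e1 : i + m + 1 - i = m + 1 := by omega
  have e2 : i + m - i = m := by omega
  unfold jc
  rw [e1, e2, Finset.prod_range_succ', Nat.factorial_succ]
  have hm : ((m : ℝ) + 1) ≠ 0 := by positivity
  have hf : (Nat.factorial m : ℝ) ≠ 0 := by positivity
  have hg : (Nat.factorial i : ℝ) ≠ 0 := by positivity
  have h1 : ∏ j ∈ Finset.range m, (α + (i : ℝ) + ((j + 1 : ℕ) : ℝ) + 1)
      = ∏ j ∈ Finset.range m, (α + 1 + (i : ℝ) + (j : ℝ) + 1) :=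
    Finset.prod_congr rfl fun j _ => by push_cast; ring
  have h2 : ∏ j ∈ Finset.range i, (β + ((m + 1 : ℕ) : ℝ) + (j : ℝ) + 1)
      = ∏ j ∈ Finset.range i, (β + 1 + (m : ℝ) + (j : ℝ) + 1) :=
    Finset.prod_congr rfl fun j _ => by push_cast; ring
  rw [h1, h2]
  push_cast
  field_simp
  ring

lemma jc_rel2 (n : ℕ) (α β : ℝ) (i : ℕ) (hi : i ≤ n) :
    ((i : ℝ) + 1) * jc (n + 1) α β (i + 1)
      = (β + 1 + n - i) * jc n (α + 1) (β + 1) i := by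
  obtain ⟨m, rfl⟩ := Nat.exists_eq_add_of_le hi
  have e1 : i + m + 1 - (i + 1) = m := by omega
  have e2 : i + m - i = m := by omega
  unfold jc
  rw [e1, e2, Finset.prod_range_succ' _ i, Nat.factorial_succ i]
  have hm : ((i : ℝ) + 1) ≠ 0 := by positivity
  have hf : (Nat.factorial m : ℝ) ≠ 0 := by positivity
  have hg : (Nat.factorial i : ℝ) ≠ 0 := by positivity
  have h1 : ∏ j ∈ Finset.range m, (α + ((i + 1 : ℕ) : ℝ) + (j : ℝ) + 1)
      = ∏ j ∈ Finset.range m, (α + 1 + (i : ℝ) + (j : ℝ) + 1) :=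
    Finset.prod_congr rfl fun j _ => by push_cast; ring
  have h2 : ∏ j ∈ Finset.range i, (β + (m : ℝ) + ((j + 1 : ℕ) : ℝ) + 1)
      = ∏ j ∈ Finset.range i, (β + 1 + (m : ℝ) + (j : ℝ) + 1) :=
    Finset.prod_congr rfl fun j _ => by push_cast; ring
  rw [h1, h2]
  push_cast
  field_simp
  ring

/-- The Jacobi polynomial as an element of `ℝ[X]`. -/
noncomputable def jp (k : ℕ) (α β : ℝ) : ℝ[X] :=
  ∑ i ∈ Finset.range (k + 1),
    C (jc k α β i) * (C (1/2) * (X - 1)) ^ i * (C (1/2) * (X + 1)) ^ (k - i)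

lemma jp_eval (k : ℕ) (α β x : ℝ) : (jp k α β).eval x = jacobi k α β x := by
  unfold jp jacobi
  rw [eval_finsetSum]
  refine Finset.sum_congr rfl fun i _ => ?_
  have a1 : (1 / 2 * (x - 1)) = (x - 1) / 2 := by ring
  have a2 : (1 / 2 * (x + 1)) = (x + 1) / 2 := by ring
  simp only [eval_mul, eval_pow, eval_C, eval_sub, eval_add, eval_X, eval_one, a1, a2, jc]

lemma jp_natDegree (k : ℕ) (α β : ℝ) : (jp k α β).natDegree ≤ k := by
  unfold jp
  refine natDegree_sum_le_of_forall_le _ _ fun i hi => ?_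
  have hi' : i ≤ k := by simpa [Nat.lt_succ_iff] using hi
  have h1 : (C (1/2 : ℝ) * (X - 1)).natDegree ≤ 1 := by compute_degree
  have h2 : (C (1/2 : ℝ) * (X + 1)).natDegree ≤ 1 := by compute_degree
  refine natDegree_mul_le.trans ?_
  have := natDegree_pow_le_of_le i h1
  have := natDegree_pow_le_of_le (k - i) h2
  have := natDegree_C_mul_le (jc k α β i) ((C (1/2 : ℝ) * (X - 1)) ^ i)
  omega

lemma jp_eval_neg_one (k : ℕ) (α β : ℝ) (hβ : -1 < β) : (jp k α β).eval (-1) ≠ 0 := by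
  unfold jp
  rw [eval_finsetSum, Finset.sum_range_succ, Finset.sum_eq_zero]
  · simp [jc]
    refine ⟨⟨Finset.prod_ne_zero_iff.2 fun j _ => ?_, by positivity⟩, fun h => by norm_num at h⟩
    have : (0 : ℝ) ≤ j := by positivity
    linarith
  · intro i hi
    have : k - i ≠ 0 := by simp at hi; omega
    simp [this]

lemma jp_deriv (n : ℕ) (α β : ℝ) :
    derivative (jp (n + 1) α β) = C ((n + α + β + 2) / 2) * jp n (α + 1) (β + 1) := by
  have key : ∀ i, derivative (C (jc (n+1) α β i) * (C (1/2) * (X - 1)) ^ i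
      * (C (1/2) * (X + 1)) ^ (n + 1 - i) : ℝ[X])
      = C ((i : ℝ) / 2 * jc (n+1) α β i) * (C (1/2) * (X - 1)) ^ (i - 1)
        * (C (1/2) * (X + 1)) ^ (n + 1 - i)
       + C (((n + 1 - i : ℕ) : ℝ) / 2 * jc (n+1) α β i) * (C (1/2) * (X - 1)) ^ i
        * (C (1/2) * (X + 1)) ^ (n - i) := by
    intro i
    have e : n + 1 - i - 1 = n - i := by omega
    have ed : ∀ t : ℝ, (C (t / 2) : ℝ[X]) = C t * C (1/2) := fun t => by
      rw [← C_mul]; congr 1; ring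
    rw [C_mul, C_mul, ed (i : ℝ), ed ((n + 1 - i : ℕ) : ℝ)]
    simp only [derivative_mul, derivative_pow, derivative_C, derivative_sub, derivative_add,
      derivative_X, derivative_one, e]
    ring
  unfold jp
  rw [derivative_sum, Finset.sum_congr rfl fun i _ => key i, Finset.sum_add_distrib,
    Finset.sum_range_succ', Finset.sum_range_succ _ (n + 1), Finset.mul_sum]
  simp only [Nat.cast_zero, zero_div, zero_mul, C_0, add_zero, Nat.sub_self, Nat.add_sub_cancel]
  rw [← Finset.sum_add_distrib]
  refine Finset.sum_congr rfl fun i hi => ?_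
  have hi' : i ≤ n := by simpa [Nat.lt_succ_iff] using hi
  have e : n + 1 - (i + 1) = n - i := by omega
  rw [e, ← add_mul, ← add_mul, ← C_add, ← mul_assoc, ← mul_assoc, ← C_mul]
  congr 3
  have h1 := jc_rel1 n α β i hi'
  have h2 := jc_rel2 n α β i hi'
  rw [Nat.cast_sub (by omega)]
  push_cast
  linear_combination h1 / 2 + h2 / 2

lemma jp_raise (n : ℕ) (α β x : ℝ) :
    (1 - x ^ 2) * (derivative (jp n (α + 1) (β + 1))).eval x
      + (β - α - (α + β + 2) * x) * (jp n (α + 1) (β + 1)).eval x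
      = -2 * (n + 1) * (jp (n + 1) α β).eval x := by
  set u : ℝ := (x - 1) / 2 with hu
  set v : ℝ := (x + 1) / 2 with hv
  have hx1 : 1 - x ^ 2 = -4 * u * v := by rw [hu, hv]; ring
  have hx2 : (β - α - (α + β + 2) * x) = -2 * ((α + 1) * v + (β + 1) * u) := by
    rw [hu, hv]; ring
  have E : ∀ k a b, (jp k a b).eval x = ∑ i ∈ Finset.range (k + 1), jc k a b i * u ^ i * v ^ (k - i) := by
    intro k a b
    unfold jp
    rw [eval_finsetSum]
    refine Finset.sum_congr rfl fun i _ => ?_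
    have a1 : (1 / 2 * (x - 1)) = u := by rw [hu]; ring
    have a2 : (1 / 2 * (x + 1)) = v := by rw [hv]; ring
    simp only [eval_mul, eval_pow, eval_C, eval_sub, eval_add, eval_X, eval_one, a1, a2]
  have D : (derivative (jp n (α + 1) (β + 1))).eval x = ∑ i ∈ Finset.range (n + 1),
      jc n (α + 1) (β + 1) i * ((i : ℝ) * u ^ (i - 1) * v ^ (n - i)
        + ((n - i : ℕ) : ℝ) * u ^ i * v ^ (n - i - 1)) / 2 := by
    unfold jp
    rw [derivative_sum, eval_finsetSum]
    refine Finset.sum_congr rfl fun i _ => ?_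
    have a1 : (1 / 2 * (x - 1)) = u := by rw [hu]; ring
    have a2 : (1 / 2 * (x + 1)) = v := by rw [hv]; ring
    simp only [derivative_mul, derivative_pow, derivative_C, derivative_sub, derivative_add,
      derivative_X, derivative_one, eval_mul, eval_pow, eval_C, eval_sub, eval_add, eval_X,
      eval_one, eval_zero, a1, a2]
    ring
  have F : ((n : ℝ) + 1) * (jp (n + 1) α β).eval x = ∑ i ∈ Finset.range (n + 1),
      ((α + 1 + i) * jc n (α + 1) (β + 1) i * u ^ i * v ^ (n + 1 - i)
      + (β + 1 + n - i) * jc n (α + 1) (β + 1) i * u ^ (i + 1) * v ^ (n - i)) := by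
    rw [Finset.sum_add_distrib]
    have s1 : ∑ i ∈ Finset.range (n + 1), (α + 1 + i) * jc n (α + 1) (β + 1) i * u ^ i * v ^ (n + 1 - i)
        = ∑ i ∈ Finset.range (n + 2), ((n : ℝ) + 1 - i) * jc (n + 1) α β i * u ^ i * v ^ (n + 1 - i) := by
      rw [Finset.sum_range_succ _ (n + 1)]
      push_cast
      simp only [sub_self, zero_mul, add_zero]
      refine Finset.sum_congr rfl fun i hi => ?_
      have hi' : i ≤ n := by simpa [Nat.lt_succ_iff] using hi
      rw [jc_rel1 n α β i hi']
    have s2 : ∑ i ∈ Finset.range (n + 1), (β + 1 + n - i) * jc n (α + 1) (β + 1) i * u ^ (i + 1) * v ^ (n - i)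
        = ∑ i ∈ Finset.range (n + 2), (i : ℝ) * jc (n + 1) α β i * u ^ i * v ^ (n + 1 - i) := by
      rw [Finset.sum_range_succ' _ (n + 1)]
      simp only [Nat.cast_zero, zero_mul, add_zero]
      refine Finset.sum_congr rfl fun i hi => ?_
      have hi' : i ≤ n := by simpa [Nat.lt_succ_iff] using hi
      have e : n + 1 - (i + 1) = n - i := by omega
      push_cast
      rw [← jc_rel2 n α β i hi']
    rw [s1, s2, ← Finset.sum_add_distrib, E, Finset.mul_sum]
    refine Finset.sum_congr rfl fun i hi => ?_
    ring
  rw [mul_assoc (-2 : ℝ), F, D, E, hx1, hx2, Finset.mul_sum, Finset.mul_sum, Finset.mul_sum, ← Finset.sum_add_distrib]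
  refine Finset.sum_congr rfl fun i hi => ?_
  have hi' : i ≤ n := by simpa [Nat.lt_succ_iff] using hi
  obtain ⟨m, rfl⟩ := Nat.exists_eq_add_of_le hi'
  have e1 : i + m + 1 - i = m + 1 := by omega
  have e2 : i + m - i = m := by omega
  rw [e1, e2]
  have hi2 : (i : ℝ) * u ^ (i - 1) * u = i * u ^ i := by
    rcases i with _ | i
    · simp
    · rw [Nat.add_sub_cancel]; ring
  have hm2 : (m : ℝ) * v ^ (m - 1) * v = m * v ^ m := by
    rcases m with _ | m
    · simp
    · rw [Nat.add_sub_cancel]; ring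
  push_cast
  linear_combination (-2 * jc (i + m) (α + 1) (β + 1) i * v ^ m * v) * hi2 + (-2 * jc (i + m) (α + 1) (β + 1) i * u ^ i * u) * hm2

lemma jp_ode (n : ℕ) (α β x : ℝ) :
    (1 - x ^ 2) * (derivative (derivative (jp (n + 1) α β))).eval x
      + (β - α - (α + β + 2) * x) * (derivative (jp (n + 1) α β)).eval x
      + (n + 1) * (n + α + β + 2) * (jp (n + 1) α β).eval x = 0 := by
  have h := jp_raise n α β x
  rw [jp_deriv, derivative_C_mul]
  simp only [eval_mul, eval_C]
  linear_combination ((n + α + β + 2) / 2) * h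

lemma laguerre_prod (c : ℝ) (Z : Finset ℝ) (x : ℝ) :
    0 ≤ ((derivative (C c * ∏ z ∈ Z, (X - C z))).eval x) ^ 2
      - (C c * ∏ z ∈ Z, (X - C z)).eval x
        * (derivative (derivative (C c * ∏ z ∈ Z, (X - C z)))).eval x := by
  classical
  induction Z using Finset.induction_on with
  | empty => simp
  | insert a Z ha ih =>
    rw [Finset.prod_insert ha, mul_left_comm]
    set G := C c * ∏ z ∈ Z, (X - C z) with hG
    simp only [derivative_mul, derivative_sub, derivative_X, derivative_C, derivative_add,
      derivative_one, derivative_zero, eval_mul, eval_add, eval_sub, eval_X, eval_C, eval_one,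
      eval_zero]
    nlinarith [mul_nonneg (sq_nonneg (x - a)) ih, sq_nonneg (eval x G)]

lemma jp_zeros (k : ℕ) : ∀ α β : ℝ, -1 < α → -1 < β → ∃ z : ℕ → ℝ, z 0 = -1 ∧ z (k + 1) = 1 ∧
    (∀ i ≤ k, z i < z (i + 1)) ∧ ∀ i < k, (jp k α β).eval (z (i + 1)) = 0 := by
  induction k with
  | zero =>
    intro α β _ _
    refine ⟨fun i => 2 * i - 1, by norm_num, by norm_num, ?_, by simp⟩
    intro i hi
    push_cast
    linarith
  | succ k ih =>
    intro α β hα hβ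
    obtain ⟨z, z0, z1, zm, zr⟩ := ih (α + 1) (β + 1) (by linarith) (by linarith)
    have lo : ∀ i ≤ k + 1, -1 ≤ z i := by
      intro i
      induction i with
      | zero => intro _; exact z0.ge
      | succ i ih2 => intro hi; exact (ih2 (by omega)).trans (zm i (by omega)).le
    have hi1 : ∀ j ≤ k + 1, z (k + 1 - j) ≤ 1 := by
      intro j
      induction j with
      | zero => intro _; exact z1.le
      | succ j ih2 =>
        intro hj
        have := zm (k + 1 - (j + 1)) (by omega)
        rw [show k + 1 - (j + 1) + 1 = k + 1 - j by omega] at this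
        exact this.le.trans (ih2 (by omega))
    have hi : ∀ i ≤ k + 1, z i ≤ 1 := by
      intro i h
      have := hi1 (k + 1 - i) (by omega)
      rwa [show k + 1 - (k + 1 - i) = i by omega] at this
    have step : ∀ i, i ≤ k → ∃ c, z i < c ∧ c < z (i + 1) ∧ (jp (k + 1) α β).eval c = 0 := by
      intro i hik
      let g := jp k (α + 1) (β + 1)
      let F : ℝ → ℝ := fun x => (1 - x) ^ (α + 1) * (1 + x) ^ (β + 1) * g.eval x
      have Fz : ∀ j ≤ k + 1, F (z j) = 0 := by
        intro j hj
        rcases Nat.eq_zero_or_pos j with h | h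
        · subst h
          simp only [F, z0]
          rw [show (1 : ℝ) + -1 = 0 by norm_num, Real.zero_rpow (by linarith)]
          simp
        · rcases Nat.lt_or_ge j (k + 1) with h' | h'
          · obtain ⟨j, rfl⟩ := Nat.exists_eq_add_of_lt h
            have := zr (0 + j) (by omega)
            simp only [F, g]
            rw [this, mul_zero]
          · have : j = k + 1 := by omega
            subst this
            simp only [F, z1]
            rw [sub_self, Real.zero_rpow (by linarith)]
            simp
      have Fd : ∀ x ∈ Set.Ioo (z i) (z (i + 1)), HasDerivAt F
          (((-1) * (α + 1) * (1 - x) ^ (α + 1 - 1) * (1 + x) ^ (β + 1)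
            + (1 - x) ^ (α + 1) * (1 * (β + 1) * (1 + x) ^ (β + 1 - 1))) * g.eval x
            + (1 - x) ^ (α + 1) * (1 + x) ^ (β + 1) * (derivative g).eval x) x := by
        intro x hx
        have h1 : -1 < x := (lo i (by omega)).trans_lt hx.1
        have h2 : x < 1 := hx.2.trans_le (hi (i + 1) (by omega))
        have d1 : HasDerivAt (fun x : ℝ => 1 - x) (-1) x := by
          simpa using (hasDerivAt_id x).const_sub 1
        have d2 : HasDerivAt (fun x : ℝ => 1 + x) 1 x := by
          simpa using (hasDerivAt_id x).const_add 1
        exact ((d1.rpow_const (Or.inl (by linarith))).mul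
          (d2.rpow_const (Or.inl (by linarith)))).mul (g.hasDerivAt x)
      have Fc : ContinuousOn F (Set.Icc (z i) (z (i + 1))) := by
        apply Continuous.continuousOn
        have c1 : Continuous fun x : ℝ => (1 - x) ^ (α + 1) :=
          (continuous_const.sub continuous_id).rpow_const fun _ => Or.inr (by linarith)
        have c2 : Continuous fun x : ℝ => (1 + x) ^ (β + 1) :=
          (continuous_const.add continuous_id).rpow_const fun _ => Or.inr (by linarith)
        exact (c1.mul c2).mul g.continuous
      obtain ⟨c, hc, hc0⟩ := exists_hasDerivAt_eq_zero (zm i hik) Fc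
        (by rw [Fz i (by omega), Fz (i + 1) (by omega)]) Fd
      refine ⟨c, hc.1, hc.2, ?_⟩
      have h1 : 0 < 1 + c := by linarith [(lo i (by omega)).trans_lt hc.1]
      have h2 : 0 < 1 - c := by linarith [hc.2.trans_le (hi (i + 1) (by omega))]
      rw [add_sub_cancel_right, add_sub_cancel_right, Real.rpow_add_one h1.ne',
        Real.rpow_add_one h2.ne'] at hc0
      have hr := jp_raise k α β c
      have p1 : 0 < (1 - c) ^ α := Real.rpow_pos_of_pos h2 _
      have p2 : 0 < (1 + c) ^ β := Real.rpow_pos_of_pos h1 _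
      have e : (1 - c) ^ α * (1 + c) ^ β * (-2 * (k + 1) * (jp (k + 1) α β).eval c) = 0 := by
        rw [← hr, ← hc0]
        ring
      have hk : (k : ℝ) + 1 ≠ 0 := by positivity
      simpa [p1.ne', p2.ne', hk] using e
    choose! c hc1 hc2 hc3 using step
    refine ⟨fun i => if i = 0 then -1 else if i ≤ k + 1 then c (i - 1) else 1, by simp, by simp,
      ?_, ?_⟩
    · intro i hik
      rcases Nat.eq_zero_or_pos i with h | h
      · subst h
        simpa [z0] using hc1 0 (by omega)
      · rcases Nat.lt_or_ge i (k + 1) with h' | h'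
        · have a1 : i ≠ 0 := by omega
          have a2 : i ≤ k + 1 := by omega
          have a3 : i ≤ k := by omega
          simp only [a1, a2, a3, if_true, if_false, Nat.add_sub_cancel, Nat.succ_ne_zero,
            Nat.add_le_add_iff_right]
          have b1 := hc2 (i - 1) (by omega)
          have b2 := hc1 i a3
          rw [show i - 1 + 1 = i by omega] at b1
          exact b1.trans b2
        · have : i = k + 1 := by omega
          subst this
          simpa [z1] using hc2 k le_rfl
    · intro i hik
      have a3 : i ≤ k := by omega
      simpa [a3] using hc3 i a3

lemma jp_factor (k : ℕ) (α β : ℝ) (hα : -1 < α) (hβ : -1 < β) :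
    ∃ (c : ℝ) (Z : Finset ℝ), c ≠ 0 ∧ (∀ z ∈ Z, -1 < z ∧ z < 1) ∧
      jp k α β = C c * ∏ z ∈ Z, (X - C z) := by
  classical
  obtain ⟨z, z0, z1, zm, zr⟩ := jp_zeros k α β hα hβ
  have hp : jp k α β ≠ 0 := fun h => jp_eval_neg_one k α β hβ (by rw [h]; simp)
  have mono : ∀ d i, i + d + 1 ≤ k + 1 → z i < z (i + d + 1) := by
    intro d
    induction d with
    | zero => intro i h; exact zm i (by omega)
    | succ d ih =>
      intro i h
      exact (ih i (by omega)).trans (zm (i + d + 1) (by omega))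
  have mono' : ∀ i j, i < j → j ≤ k + 1 → z i < z j := by
    intro i j hij hj
    obtain ⟨d, rfl⟩ := Nat.exists_eq_add_of_lt hij
    exact mono d i hj
  let Z := (Finset.range k).image fun i => z (i + 1)
  have hcard : Z.card = k := by
    rw [Finset.card_image_of_injOn, Finset.card_range]
    intro i hi j hj hij
    simp at hi hj
    rcases lt_trichotomy i j with h | h | h
    · exact absurd hij (mono' (i + 1) (j + 1) (by omega) (by omega)).ne
    · exact h
    · exact absurd hij (mono' (j + 1) (i + 1) (by omega) (by omega)).ne'
  have hle : Z.val ≤ (jp k α β).roots := by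
    rw [Multiset.le_iff_subset Z.nodup]
    intro y hy
    have hy : y ∈ Z := hy
    obtain ⟨i, hi, rfl⟩ := Finset.mem_image.1 hy
    exact (mem_roots hp).2 (zr i (by simpa using hi))
  have hroots : Z.val = (jp k α β).roots := by
    apply Multiset.eq_of_le_of_card_le hle
    exact ((card_roots' _).trans (jp_natDegree k α β)).trans hcard.ge
  have hdeg : (jp k α β).roots.card = (jp k α β).natDegree := by
    apply le_antisymm (card_roots' _)
    rw [← hroots]
    exact (jp_natDegree k α β).trans hcard.ge
  refine ⟨(jp k α β).leadingCoeff, Z, leadingCoeff_ne_zero.2 hp, ?_, ?_⟩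
  · intro y hy
    obtain ⟨i, hi, rfl⟩ := Finset.mem_image.1 hy
    have hi : i < k := by simpa using hi
    rw [← z0, ← z1]
    exact ⟨mono' _ _ (by omega) (by omega), mono' _ _ (by omega) (by omega)⟩
  · conv_lhs => rw [← C_leadingCoeff_mul_prod_multiset_X_sub_C hdeg, ← hroots]
    rfl

set_option maxHeartbeats 2000000 in
theorem jacobi_least_zero_gt
    (k : ℕ) (hk : 1 ≤ k) (α β : ℝ) (hβ : -1 < β) (hαβ : β ≤ α)
    (s q r R : ℝ)
    (hs : s = α + β + 1) (hq : q = α - β) (hr : r = 2 * (k : ℝ) + α + β + 1)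
    (hR : R = Real.sqrt ((r ^ 2 - q ^ 2 + 2 * s + 1) * (r ^ 2 - s ^ 2)))
    (A : ℝ) (hA : A = -(R + q * (s + 1)) / (r ^ 2 + 2 * s + 1))
    (x1 : ℝ) (hroot : jacobi k α β x1 = 0)
    (hmin : ∀ y : ℝ, jacobi k α β y = 0 → x1 ≤ y) :
    x1 > A + 3 * (1 - A ^ 2) ^ ((2 : ℝ) / 3) * (2 * R) ^ (-(1 : ℝ) / 3) := by
  classical
  have hα : -1 < α := by linarith
  obtain ⟨n, rfl⟩ : ∃ n, k = n + 1 := ⟨k - 1, by omega⟩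
  obtain ⟨c, Z, hc, hZ, hp⟩ := jp_factor (n + 1) α β hα hβ
  have hode := jp_ode n α β
  simp only [← jp_eval] at hroot hmin
  set f := jp (n + 1) α β with hf
  have hx1Z : x1 ∈ Z := by
    rw [hp, eval_mul, eval_C, eval_prod] at hroot
    have := (mul_eq_zero.1 hroot).resolve_left hc
    obtain ⟨y, hy, hy0⟩ := Finset.prod_eq_zero_iff.1 this
    have : x1 = y := by simpa [sub_eq_zero] using hy0
    exact this ▸ hy
  obtain ⟨hx1l, hx1r⟩ := hZ x1 hx1Z
  set G := C c * ∏ z ∈ Z.erase x1, (X - C z) with hG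
  have hfG : f = (X - C x1) * G := by
    rw [hp, hG, ← Finset.mul_prod_erase Z _ hx1Z]; ring
  have hGL := laguerre_prod c (Z.erase x1)
  rw [← hG] at hGL
  have hG1 : G.eval x1 ≠ 0 := by
    rw [hG, eval_mul, eval_C, eval_prod]
    refine mul_ne_zero hc (Finset.prod_ne_zero_iff.2 fun z hz => ?_)
    have := Finset.ne_of_mem_erase hz
    simpa [sub_eq_zero] using this.symm
  clear_value G
  have hGne : ∀ y ≤ x1, G.eval y ≠ 0 := by
    intro y hy h0
    have h1 := hmin y (by rw [hfG, eval_mul, h0, mul_zero])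
    have : y = x1 := le_antisymm hy h1
    exact hG1 (this ▸ h0)
  have hGsign : 0 < G.eval (-1) * G.eval x1 := by
    by_contra hcon
    have hcon' : G.eval (-1) * G.eval x1 ≤ 0 := not_lt.1 hcon
    have hcont : ContinuousOn (fun y => G.eval y) (Set.uIcc (-1) x1) := G.continuous.continuousOn
    have h0 : (0 : ℝ) ∈ Set.uIcc (G.eval (-1)) (G.eval x1) := by
      rw [Set.mem_uIcc]
      rcases mul_nonpos_iff.1 hcon' with h | h
      · exact Or.inr ⟨h.2, h.1⟩
      · exact Or.inl ⟨h.1, h.2⟩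
    obtain ⟨y, hy, hy0⟩ := intermediate_value_uIcc hcont h0
    rw [Set.uIcc_of_le hx1l.le] at hy
    exact hGne y hy.2 hy0
  have hfe : ∀ y, f.eval y = (y - x1) * G.eval y := by intro y; rw [hfG]; simp
  have hfd : ∀ y, (derivative f).eval y = G.eval y + (y - x1) * (derivative G).eval y := by
    intro y; rw [hfG]; simp
  have hfdd : ∀ y, (derivative (derivative f)).eval y
      = 2 * (derivative G).eval y + (y - x1) * (derivative (derivative G)).eval y := by
    intro y; rw [hfG]; simp; ring
  -- the auxiliary point
  obtain ⟨x, hxl, hxr, hx⟩ : ∃ x, -1 < x ∧ x < x1 ∧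
      2 * (1 - x ^ 2) * (derivative f).eval x = ((s + 1) * x + q) * f.eval x := by
    let h : ℝ → ℝ := fun y => 2 * (1 - y ^ 2) * (derivative f).eval y - ((s + 1) * y + q) * f.eval y
    have hcont : Continuous h := by
      have := f.continuous
      have := (derivative f).continuous
      fun_prop
    have e1 : h (-1) = -(2 * (β + 1) * (1 + x1)) * G.eval (-1) := by
      simp only [h, hfe, hs, hq]; ring
    have e2 : h x1 = 2 * (1 - x1 ^ 2) * G.eval x1 := by
      simp only [h, hfe, hfd]; ring
    have k1 : 0 < 2 * (β + 1) * (1 + x1) := by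
      have : 0 < β + 1 := by linarith
      have : 0 < 1 + x1 := by linarith
      positivity
    have k2 : 0 < 2 * (1 - x1 ^ 2) := by nlinarith
    have hne1 : h (-1) ≠ 0 := by
      rw [e1]; exact mul_ne_zero (neg_ne_zero.2 k1.ne') (hGne _ hx1l.le)
    have hne2 : h x1 ≠ 0 := by rw [e2]; exact mul_ne_zero k2.ne' hG1
    have hneg : h (-1) * h x1 ≤ 0 := by
      rw [e1, e2]
      nlinarith [mul_pos (mul_pos k1 k2) hGsign]
    have h0 : (0 : ℝ) ∈ Set.uIcc (h (-1)) (h x1) := by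
      rw [Set.mem_uIcc]
      rcases mul_nonpos_iff.1 hneg with h | h
      · exact Or.inr ⟨h.2, h.1⟩
      · exact Or.inl ⟨h.1, h.2⟩
    obtain ⟨y, hy, hy0⟩ := intermediate_value_uIcc hcont.continuousOn h0
    rw [Set.uIcc_of_le hx1l.le] at hy
    refine ⟨y, lt_of_le_of_ne hy.1 ?_, lt_of_le_of_ne hy.2 ?_, ?_⟩
    · rintro rfl; exact hne1 hy0
    · rintro rfl; exact hne2 hy0
    · simp only [h] at hy0; linarith
  have hw : 0 < 1 - x ^ 2 := by nlinarith
  have hGx : 0 < (G.eval x) ^ 2 := by have := hGne x hxr.le; positivity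
  have hLag : (G.eval x) ^ 2 ≤ ((derivative f).eval x) ^ 2
      - f.eval x * (derivative (derivative f)).eval x := by
    rw [hfe, hfd, hfdd]
    nlinarith [mul_nonneg (sq_nonneg (x - x1)) (hGL x)]
  have ho := hode x
  have hfx2 : (f.eval x) ^ 2 = (x1 - x) ^ 2 * (G.eval x) ^ 2 := by rw [hfe]; ring
  have hrs : r ^ 2 - s ^ 2 = 4 * ((n + 1) * (n + α + β + 2)) := by
    rw [hr, hs]; push_cast; ring
  have hmain : 4 * (1 - x ^ 2) ^ 2 ≤
      (x1 - x) ^ 2 * ((r ^ 2 - s ^ 2) * (1 - x ^ 2) - ((s + 1) * x + q) ^ 2) := by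
    have key : 4 * (1 - x ^ 2) ^ 2 * (((derivative f).eval x) ^ 2
      - f.eval x * (derivative (derivative f)).eval x) =
      ((r ^ 2 - s ^ 2) * (1 - x ^ 2) - ((s + 1) * x + q) ^ 2) * (f.eval x) ^ 2 := by
      rw [hrs]
      have hlin : β - α - (α + β + 2) * x = -((s + 1) * x + q) := by rw [hs, hq]; ring
      rw [hlin] at ho
      linear_combination (2 * (1 - x ^ 2) * (derivative f).eval x
        - ((s + 1) * x + q) * f.eval x) * hx - 4 * (1 - x ^ 2) * f.eval x * ho
    have h4 := mul_le_mul_of_nonneg_left hLag (by positivity : 0 ≤ 4 * (1 - x ^ 2) ^ 2)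
    rw [key, hfx2] at h4
    refine le_of_mul_le_mul_right ?_ hGx
    linarith
  -- final estimate
  have hn0 : (0 : ℝ) ≤ n := by positivity
  have hs1 : 0 < s + 1 := by rw [hs]; linarith
  have hq0 : 0 ≤ q := by rw [hq]; linarith
  have hqs : q < s + 1 := by rw [hs, hq]; linarith
  have hrs0 : 0 < r ^ 2 - s ^ 2 := by
    rw [hrs]
    have : 0 < (n : ℝ) + α + β + 2 := by linarith
    positivity
  have hMq : 0 < r ^ 2 - q ^ 2 + 2 * s + 1 := by
    have := mul_pos (sub_pos.2 hqs) (by linarith : 0 < s + 1 + q)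
    linarith [show (s + 1 - q) * (s + 1 + q) = s ^ 2 + 2 * s + 1 - q ^ 2 by ring]
  have hM : 0 < r ^ 2 + 2 * s + 1 := by linarith [sq_nonneg q]
  have hR0 : 0 < R := by rw [hR]; exact Real.sqrt_pos.2 (mul_pos hMq hrs0)
  have hR2 : R ^ 2 = (r ^ 2 - q ^ 2 + 2 * s + 1) * (r ^ 2 - s ^ 2) := by
    rw [hR]; exact Real.sq_sqrt (mul_pos hMq hrs0).le
  set M := r ^ 2 + 2 * s + 1 with hMdef
  obtain ⟨B, hB⟩ : ∃ B, B = (R - q * (s + 1)) / M := ⟨_, rfl⟩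
  have hMA : M * A = -(R + q * (s + 1)) := by rw [hA]; field_simp
  have hMB : M * B = R - q * (s + 1) := by rw [hB]; field_simp
  have hquad : ∀ y, (r ^ 2 - s ^ 2) * (1 - y ^ 2) - ((s + 1) * y + q) ^ 2
      = M * ((y - A) * (B - y)) := by
    intro y
    have hMAB : M * (M * (A * B)) = M * (-(r ^ 2 - s ^ 2 - q ^ 2)) := by
      have : M * (M * (A * B)) = (M * A) * (M * B) := by ring
      rw [this, hMA, hMB]
      rw [hMdef]
      linear_combination -hR2
    have hMAB' := mul_left_cancel₀ hM.ne' hMAB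
    have hMM : M - (r ^ 2 + 2 * s + 1) = 0 := by rw [hMdef]; ring
    linear_combination -y * hMA - y * hMB + hMAB' + y ^ 2 * hMM
  have hAB : A < B := by
    have : M * A < M * B := by rw [hMA, hMB]; linarith
    exact lt_of_mul_lt_mul_left this hM.le
  have hA0 : A < 0 := by
    have : M * A < 0 := by rw [hMA]; linarith [mul_nonneg hq0 hs1.le]
    exact (pos_iff_neg_of_mul_neg this).1 hM
  have hABs : A + B ≤ 0 := by
    have : M * (A + B) ≤ 0 := by rw [mul_add, hMA, hMB]; linarith [mul_nonneg hq0 hs1.le]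
    exact nonpos_of_mul_nonpos_right this hM
  rw [hquad] at hmain
  have hprod : 0 < (x - A) * (B - x) := by
    have h4 : 0 < 4 * (1 - x ^ 2) ^ 2 := by positivity
    by_contra hcon
    have : M * ((x - A) * (B - x)) ≤ 0 := mul_nonpos_of_nonneg_of_nonpos hM.le (not_lt.1 hcon)
    have := mul_nonpos_of_nonneg_of_nonpos (sq_nonneg (x1 - x)) this
    linarith
  obtain ⟨hu, hBx⟩ : 0 < x - A ∧ 0 < B - x := by
    rcases pos_and_pos_or_neg_and_neg_of_mul_pos hprod with h | h
    · exact h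
    · linarith [h.1, h.2]
  have hA1 : -1 ≤ A := by
    by_contra hcon
    have h1 := hquad (-1)
    have h2 : 0 < M * ((-1 - A) * (B - -1)) := by
      have : 0 < -1 - A := by linarith
      have : 0 < B - -1 := by linarith
      positivity
    rw [← h1] at h2
    norm_num at h2
    linarith [sq_nonneg (-1 + -s + q)]
  have hA2 : 0 ≤ 1 - A ^ 2 := by
    have := mul_nonneg (by linarith : 0 ≤ 1 + A) (by linarith : 0 ≤ 1 - A)
    linarith [show (1 + A) * (1 - A) = 1 - A ^ 2 by ring]
  have hxA : x ^ 2 ≤ A ^ 2 := by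
    have := mul_nonneg hu.le (by linarith : 0 ≤ -A - x)
    linarith [show (x - A) * (-A - x) = A ^ 2 - x ^ 2 by ring]
  set T := (1 - A ^ 2) ^ ((2 : ℝ) / 3) * (2 * R) ^ (-(1 : ℝ) / 3) with hT
  have hT0 : 0 ≤ T := by positivity
  have hT3 : T ^ 3 * (2 * R) = (1 - A ^ 2) ^ 2 := by
    have a1 : ((1 - A ^ 2) ^ ((2 : ℝ) / 3)) ^ 3 = (1 - A ^ 2) ^ 2 := by
      rw [← Real.rpow_natCast, ← Real.rpow_mul hA2, ← Real.rpow_natCast]; norm_num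
    have a2 : ((2 * R) ^ (-(1 : ℝ) / 3)) ^ 3 = (2 * R)⁻¹ := by
      rw [← Real.rpow_natCast, ← Real.rpow_mul (by positivity), ← Real.rpow_neg_one]; norm_num
    rw [hT, mul_pow, a1, a2]
    field_simp
  rw [mul_assoc, ← hT]
  clear_value T
  have hy : 0 < x1 - x := by linarith
  have h2R : M * (B - A) = 2 * R := by linear_combination hMB - hMA
  have hfin : 4 * T ^ 3 < (x - A) * (x1 - x) ^ 2 := by
    have hlt : (x - A) * (x1 - x) ^ 2 * (M * (B - x)) < (x - A) * (x1 - x) ^ 2 * (2 * R) := by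
      rw [← h2R]
      have : B - x < B - A := by linarith
      gcongr
    have hsq : (1 - A ^ 2) ^ 2 ≤ (1 - x ^ 2) ^ 2 := by
      have : 1 - A ^ 2 ≤ 1 - x ^ 2 := by linarith
      gcongr
    refine lt_of_mul_lt_mul_right (a := 2 * R) ?_ (by positivity)
    have e3 : 4 * T ^ 3 * (2 * R) = 4 * (1 - A ^ 2) ^ 2 := by rw [← hT3]; ring
    have e4 : (x1 - x) ^ 2 * (M * ((x - A) * (B - x)))
        = (x - A) * (x1 - x) ^ 2 * (M * (B - x)) := by ring
    rw [e4] at hmain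
    rw [e3]
    linarith
  have hcube : 27 * T ^ 3 < ((x - A) + (x1 - x)) ^ 3 := by
    have : 27 * ((x - A) * (x1 - x) ^ 2) ≤ 4 * ((x - A) + (x1 - x)) ^ 3 := by
      generalize x - A = u at *
      generalize x1 - x = y at *
      have : 4 * (u + y) ^ 3 - 27 * (u * y ^ 2) = (y - 2 * u) ^ 2 * (4 * y + u) := by ring
      have : 0 ≤ (y - 2 * u) ^ 2 * (4 * y + u) := by positivity
      linarith
    linarith
  have : 3 * T < (x - A) + (x1 - x) := by
    refine lt_of_pow_lt_pow_left₀ 3 (by linarith) ?_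
    linarith [show (3 * T) ^ 3 = 27 * T ^ 3 by ring]
  linarith
end

section
/- Let α ≥ β > −1 and let x_k be the largest zero of the Jacobi polynomial P_k^{(α,β)}. Then x_k < B − 3·(1 − B²)^{2/3}·(2R)^{−1/3} + 4q(s+1)/(r² + 2s + 1)^{3/2}, where s = α+β+1, q = α−β, r = 2k+α+β+1, R = √((r²−q²+2s+1)(r²−s²)), and B = (R − q(s+1))/(r² + 2s + 1). -/
lemma amgm_aux (c D η : ℝ) (hc : 0 ≤ c) (hD : 0 < D) (hη : 0 < η) :
    3 * c ^ ((2 : ℝ) / 3) * D ^ (-(1 : ℝ) / 3) ≤ η + 2 * (c / √(D * η)) := by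
  set w := c / √(D * η) with hw
  set T := c ^ ((2 : ℝ) / 3) * D ^ (-(1 : ℝ) / 3) with hT
  have hw0 : 0 ≤ w := by positivity
  have hT0 : 0 ≤ T := by positivity
  have h1 : T ^ 3 = c ^ 2 / D := by
    rw [hT, mul_pow, ← Real.rpow_mul_natCast hc, ← Real.rpow_mul_natCast hD.le]
    norm_num
    rw [Real.rpow_neg_one, div_eq_mul_inv]
  have h2 : η * w ^ 2 = c ^ 2 / D := by
    rw [hw, div_pow, Real.sq_sqrt (by positivity)]
    field_simp
  have h3 : (3 * T) ^ 3 ≤ (η + 2 * w) ^ 3 := by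
    have : (3 * T) ^ 3 = 27 * (η * w ^ 2) := by rw [h2, ← h1]; ring
    rw [this]
    nlinarith [mul_nonneg hη.le (sq_nonneg (η - w)), mul_nonneg hw0 (sq_nonneg (η - w))]
  have h4 : 3 * T ≤ η + 2 * w := le_of_pow_le_pow_left₀ (by norm_num) (by positivity) h3
  calc _ = 3 * T := by rw [hT]; ring
    _ ≤ _ := h4

set_option maxHeartbeats 1000000 in
lemma final_aux (M h m x y E T : ℝ) (hE : 0 < E) (hEM : E ^ 2 = M) (hh : 0 < h) (hm : 0 ≤ m)
    (hB : (h - m) ^ 2 ≤ 1) (hA : (h + m) ^ 2 ≤ 1) (hy1 : y < h - m) (hy2 : -h - m < y)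
    (hxy : x < y)
    (hmain : 4 * (1 - y ^ 2) ^ 2 ≤ M * (h - m - y) * (y - (-h - m)) * (y - x) ^ 2)
    (hhm : 4 * m ≤ h * E)
    (hT : ∀ η, 0 < η → T ≤ η + 2 * ((1 - (h - m) ^ 2) / √(2 * (h * M) * η))) :
    x < h - m - T + 4 * m / E := by
  obtain ⟨η, hη⟩ : ∃ η, η = h - m - y := ⟨_, rfl⟩
  have hη0 : 0 < η := by linarith
  have hη2 : 0 < 2 * h - η := by linarith
  have hyη : y = h - m - η := by linarith
  set P := √(η * (2 * h - η)) with hP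
  have hP0 : 0 < P := Real.sqrt_pos.2 (by positivity)
  have hP2 : P ^ 2 = η * (2 * h - η) := Real.sq_sqrt (by positivity)
  have hkey : 2 * (1 - y ^ 2) / (E * P) ≤ y - x := by
    rw [div_le_iff₀ (by positivity)]
    have hnn : 0 ≤ (y - x) * (E * P) := mul_nonneg (by linarith) (mul_pos hE hP0).le
    refine le_of_pow_le_pow_left₀ two_ne_zero hnn ?_
    calc (2 * (1 - y ^ 2)) ^ 2 = 4 * (1 - y ^ 2) ^ 2 := by ring
      _ ≤ _ := hmain
      _ = ((y - x) * (E * P)) ^ 2 := by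
        rw [mul_pow, mul_pow, hEM, hP2, hyη]; ring
  have hxe : x = h - m - (η + (y - x)) := by linarith
  have hid : 1 - y ^ 2 = (1 - (h - m) ^ 2) + P ^ 2 - 2 * m * η := by rw [hP2, hyη]; ring
  have hid2 : 2 * (1 - y ^ 2) / (E * P) =
      2 / E * ((1 - (h - m) ^ 2) / P + P - 2 * m * (η / P)) := by
    rw [hid]; field_simp
  rcases le_total η h with hc | hc
  · have h1 := hT η hη0
    have hs : √(2 * (h * M) * η) = E * √(2 * h * η) := by
      rw [← hEM, show 2 * (h * E ^ 2) * η = E ^ 2 * (2 * h * η) by ring,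
        Real.sqrt_mul (by positivity), Real.sqrt_sq hE.le]
    have h2 : P ≤ √(2 * h * η) := Real.sqrt_le_sqrt (by nlinarith)
    have h3 : (1 - (h - m) ^ 2) / √(2 * h * η) ≤ (1 - (h - m) ^ 2) / P :=
      div_le_div_of_nonneg_left (by linarith) hP0 h2
    have h4 : η / P ≤ 1 := by
      rw [div_le_one hP0]
      apply Real.le_sqrt_of_sq_le; nlinarith
    have h5 : 2 * ((1 - (h - m) ^ 2) / √(2 * (h * M) * η)) =
      2 / E * ((1 - (h - m) ^ 2) / √(2 * h * η)) := by rw [hs]; field_simp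
    have h6 : 2 / E * ((1 - (h - m) ^ 2) / √(2 * h * η) - 2 * m) <
        2 / E * ((1 - (h - m) ^ 2) / P + P - 2 * m * (η / P)) := by
      apply mul_lt_mul_of_pos_left _ (by positivity)
      nlinarith
    have h7 : 4 * m / E = 2 / E * (2 * m) := by ring
    rw [h7]
    rw [mul_sub] at h6
    linarith
  · obtain ⟨z, hz⟩ : ∃ z, z = η - h := ⟨_, rfl⟩
    have hz0 : 0 ≤ z := by linarith
    have hzh : 0 < h - z := by linarith
    have h1 := hT (h / 2) (by positivity)
    have hs : √(2 * (h * M) * (h / 2)) = E * h := by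
      rw [← hEM, show 2 * (h * E ^ 2) * (h / 2) = (E * h) ^ 2 by ring,
        Real.sqrt_sq (by positivity)]
    rw [hs] at h1
    obtain ⟨c, hcdef⟩ : ∃ c, c = 1 - m ^ 2 - h ^ 2 := ⟨_, rfl⟩
    have hc2 : 2 * m * h ≤ c := by
      have : (h + m) ^ 2 = h ^ 2 + 2 * m * h + m ^ 2 := by ring
      linarith
    have hPh : P ≤ h := by
      apply Real.sqrt_le_iff.2 ⟨hh.le, by
        linarith [show h ^ 2 - η * (2 * h - η) = (η - h) ^ 2 by ring, sq_nonneg (η - h)]⟩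
    have e1 : (1 - (h - m) ^ 2) / P + P - 2 * m * (η / P) = c / P + P - 2 * m * (z / P) := by
      have : 1 - (h - m) ^ 2 = c + 2 * m * h := by rw [hcdef]; ring
      rw [this, hz]; ring
    have e2 : 2 * ((1 - (h - m) ^ 2) / (E * h)) - 4 * m / E = 2 / E * (c / h) := by
      have : 1 - (h - m) ^ 2 = c + 2 * m * h := by rw [hcdef]; ring
      rw [this]; field_simp; ring
    have hi : 1 / h ≤ 1 / P := one_div_le_one_div_of_le hP0 hPh
    have g1 : 2 * m * h * (1 / P - 1 / h) ≤ c * (1 / P - 1 / h) :=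
      mul_le_mul_of_nonneg_right hc2 (by linarith)
    have g2 : 2 * m * (h - z) * (1 / h) ≤ 2 * m * (h - z) * (1 / P) :=
      mul_le_mul_of_nonneg_left hi (by positivity)
    have g3 : 2 * m * h * (1 / h) = 2 * m := by field_simp
    have g4 : 2 * m * (h - z) * (1 / h) = 2 * m - 2 * m * (z / h) := by field_simp
    have g5 : c / h - 2 * m * (z / h) < c / P + P - 2 * m * (z / P) := by
      have i1 : c / P = c * (1 / P) := by ring
      have i2 : c / h = c * (1 / h) := by ring
      have i3 : 2 * m * (z / P) = 2 * m * z * (1 / P) := by ring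
      rw [mul_sub, mul_sub] at g1
      have i4 : 2 * m * (h - z) * (1 / P) = 2 * m * h * (1 / P) - 2 * m * z * (1 / P) := by ring
      linarith
    have g6 : 2 / E * (c / h - 2 * m * (z / h)) < 2 / E * (c / P + P - 2 * m * (z / P)) :=
      mul_lt_mul_of_pos_left g5 (by positivity)
    have g7 : 2 / E * (2 * m * (z / h)) ≤ z := by
      rw [show 2 / E * (2 * m * (z / h)) = (4 * m * z) / (h * E) by field_simp; ring]
      rw [div_le_iff₀ (by positivity)]
      have := mul_le_mul_of_nonneg_right hhm hz0
      linarith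
    rw [mul_sub] at g6
    rw [hid2, e1] at hkey
    linarith

open Polynomial in
lemma simple_root {K : Type*} [Field K] [CharZero K] (f : K[X]) (hf : f ≠ 0) (S q l z : K)
    (ode : (1 - X ^ 2) * derivative (derivative f) - (C S * X + C q) * derivative f + C l * f = 0)
    (hz : f.eval z = 0) (hz1 : 1 - z ^ 2 ≠ 0) :
    ∃ g : K[X], f = (X - C z) * g ∧ g.eval z ≠ 0 ∧
      2 * (1 - z ^ 2) * (derivative g).eval z = (S * z + q) * g.eval z := by
  obtain ⟨g, hg, hnd⟩ := exists_eq_pow_rootMultiplicity_mul_and_not_dvd f hf z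
  rw [dvd_iff_isRoot, IsRoot.def] at hnd
  generalize rootMultiplicity z f = m at hg
  match m, hg with
  | 0, hg => simp [hg] at hz; exact absurd hz hnd
  | 1, hg =>
    rw [pow_one] at hg
    refine ⟨g, hg, hnd, ?_⟩
    have := congrArg (eval z) ode
    simp [hg] at this
    linear_combination this
  | n + 2, hg =>
    exfalso
    have e : (X - C z) ^ n * ((1 - X ^ 2) * (((n : K[X]) + 2) * ((n : K[X]) + 1) * g
        + (X - C z) * (2 * ((n : K[X]) + 2) * derivative g + (X - C z) * derivative (derivative g)))
        - (X - C z) * ((C S * X + C q) * (((n : K[X]) + 2) * g + (X - C z) * derivative g))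
        + (X - C z) ^ 2 * (C l * g)) = 0 := by
      rw [← ode, hg]
      simp only [derivative_mul, derivative_pow, derivative_sub, derivative_X, derivative_C,
        derivative_add, derivative_natCast, map_natCast, derivative_one, Nat.cast_add, Nat.cast_ofNat, Nat.cast_one,
        map_add, map_ofNat, map_one]
      simp only [Nat.add_sub_cancel, show n + 2 - 1 = n + 1 by omega]
      simp
      try ring
    have e2 := (mul_eq_zero.1 e).resolve_left (pow_ne_zero _ (X_sub_C_ne_zero z))
    have := congrArg (eval z) e2
    simp at this
    rcases this with h | h
    · exact hz1 h
    · rcases h with h | h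
      · rcases h with h | h
        · norm_cast at h
        · norm_cast at h
      · exact hnd h

open Polynomial in
lemma roots_im_nonpos (F : ℂ[X]) (hF : F ≠ 0) (a b l : ℝ) (ha : 0 < a) (hb : 0 < b)
    (ode : (1 - X ^ 2) * derivative (derivative F) -
      (C ((a + b : ℝ) : ℂ) * X + C ((a - b : ℝ) : ℂ)) * derivative F + C (l : ℂ) * F = 0)
    (w : ℂ) (hw : F.eval w = 0) : w.im ≤ 0 := by
  by_contra! hpos
  obtain ⟨z, hz, hmax⟩ := Finset.exists_max_image F.roots.toFinset Complex.im
    ⟨w, by simp [hF, hw]⟩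
  have hz' : F.eval z = 0 := by simpa [hF] using hz
  have hzpos : 0 < z.im := lt_of_lt_of_le hpos (hmax w (by simp [hF, hw]))
  have hm1 : z - 1 ≠ 0 := fun h => by
    have := congrArg Complex.im h; simp at this; linarith
  have hp1 : z + 1 ≠ 0 := fun h => by
    have := congrArg Complex.im h; simp at this; linarith
  have hz1 : 1 - z ^ 2 ≠ 0 := by
    rw [show 1 - z ^ 2 = -((z - 1) * (z + 1)) by ring]
    exact neg_ne_zero.2 (mul_ne_zero hm1 hp1)
  obtain ⟨g, hfg, hg0, hg⟩ := simple_root F hF _ _ _ z ode hz' hz1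
  have hs := (IsAlgClosed.splits g).eval_derivative_div_eval_of_ne_zero hg0
  have key : (derivative g).eval z / g.eval z + (a / 2 : ℝ) * (z - 1)⁻¹ + (b / 2 : ℝ) * (z + 1)⁻¹ = 0 := by
    field_simp
    push_cast at hg ⊢
    linear_combination (-1 / 2) * hg
  have imneg : ∀ u : ℂ, 0 ≤ u.im → (u⁻¹).im ≤ 0 := fun u hu => by
    rw [Complex.inv_im]
    exact div_nonpos_of_nonpos_of_nonneg (by linarith) (Complex.normSq_nonneg _)
  have imneg' : ∀ u : ℂ, 0 < u.im → (u⁻¹).im < 0 := fun u hu => by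
    rw [Complex.inv_im]
    exact div_neg_of_neg_of_pos (by linarith) (Complex.normSq_pos.2 (fun h => by simp [h] at hu))
  have h1 := imneg' (z - 1) (by simpa using hzpos)
  have h2 := imneg' (z + 1) (by simpa using hzpos)
  have hroots : ∀ r ∈ g.roots, r.im ≤ z.im := by
    intro r hr
    apply hmax
    have hr' : g.eval r = 0 := (mem_roots'.1 hr).2
    simp only [Multiset.mem_toFinset, mem_roots', IsRoot.def]
    refine ⟨hF, ?_⟩
    rw [hfg]; simp [hr']
  have h3 : ((derivative g).eval z / g.eval z).im ≤ 0 := by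
    rw [hs]
    generalize g.roots = s at hroots
    induction s using Multiset.induction_on with
    | empty => simp
    | cons r s ih =>
      simp only [Multiset.map_cons, Multiset.sum_cons, Complex.add_im]
      have i1 := ih (fun r hr => hroots r (Multiset.mem_cons_of_mem hr))
      have i2 := imneg (z - r) (by simpa using hroots r (Multiset.mem_cons_self _ _))
      rw [one_div]
      linarith
  have := congrArg Complex.im key
  simp only [Complex.add_im, Complex.im_ofReal_mul, Complex.zero_im] at this
  nlinarith [mul_pos (half_pos ha) (neg_pos.2 h1), mul_pos (half_pos hb) (neg_pos.2 h2)]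

open Polynomial in
lemma splits_of_ode (f : ℝ[X]) (hf : f ≠ 0) (a b l : ℝ) (ha : 0 < a) (hb : 0 < b)
    (ode : (1 - X ^ 2) * derivative (derivative f) -
      (C (a + b) * X + C (a - b)) * derivative f + C l * f = 0) : f.Splits := by
  have hF : f.map (algebraMap ℝ ℂ) ≠ 0 := by
    rwa [Polynomial.map_ne_zero_iff (algebraMap ℝ ℂ).injective]
  have ode' := congrArg (Polynomial.map (algebraMap ℝ ℂ)) ode
  simp only [Polynomial.map_add, Polynomial.map_sub, Polynomial.map_mul, Polynomial.map_pow,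
    Polynomial.map_X, Polynomial.map_C, Polynomial.map_one, Polynomial.map_zero,
    ← derivative_map] at ode'
  have him := roots_im_nonpos _ hF a b l ha hb (by
    simpa using ode')
  refine Splits.of_splits_map (algebraMap ℝ ℂ) (IsAlgClosed.splits _) ?_
  intro z hz
  have hz0 : (f.map (algebraMap ℝ ℂ)).eval z = 0 := (mem_roots'.1 hz).2
  have hz1 : (f.map (algebraMap ℝ ℂ)).eval (starRingEnd ℂ z) = 0 := by
    rw [eval_map_algebraMap] at hz0 ⊢
    rw [aeval_conj, hz0, map_zero]
  have h1 := him z hz0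
  have h2 := him _ hz1
  simp at h2
  exact ⟨z.re, Complex.ext (by simp) (by simp; linarith)⟩

open Polynomial in
lemma laguerre_splits (g : ℝ[X]) (hg : g.Splits) (y : ℝ) :
    g.eval y * (derivative (derivative g)).eval y ≤ ((derivative g).eval y) ^ 2 := by
  rw [hg.eq_prod_roots]
  generalize g.leadingCoeff = c
  generalize g.roots = s
  have : ∀ s : Multiset ℝ, ((s.map fun a => X - C a).prod).eval y *
      (derivative (derivative (s.map fun a => X - C a).prod)).eval y ≤
      ((derivative (s.map fun a => X - C a).prod).eval y) ^ 2 := by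
    intro s
    induction s using Multiset.induction_on with
    | empty => simp
    | cons r s ih =>
      simp only [Multiset.map_cons, Multiset.prod_cons]
      generalize (s.map fun a => X - C a).prod = p at *
      simp
      nlinarith [mul_nonneg (sq_nonneg (y - r)) (sub_nonneg.2 ih), sq_nonneg (p.eval y)]
  have h := this s
  simp only [derivative_mul, derivative_C, zero_mul, zero_add, eval_mul, eval_C]
  nlinarith [mul_nonneg (sq_nonneg c) (sub_nonneg.2 h)]

open Polynomial in
/-- the key inequality -/
lemma key_point (f : ℝ[X]) (hf : f ≠ 0) (a b l x : ℝ) (ha : 0 < a) (hb : 0 < b)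
    (ode : (1 - X ^ 2) * derivative (derivative f) -
      (C (a + b) * X + C (a - b)) * derivative f + C l * f = 0)
    (hx : f.eval x = 0) (hmax : ∀ y, f.eval y = 0 → y ≤ x) (hx1 : -1 < x) (hx2 : x < 1) :
    ∃ y, x < y ∧ y < 1 ∧
      4 * (1 - y ^ 2) ^ 2 ≤ (4 * l * (1 - y ^ 2) - ((a + b) * y + (a - b)) ^ 2) * (y - x) ^ 2 := by
  have hxx : 0 < 1 - x ^ 2 := by nlinarith
  obtain ⟨g, hfg, hg0, hg⟩ := simple_root f hf _ _ _ x ode hx hxx.ne'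
  have hgs : g.Splits := by
    have h1 := splits_of_ode f hf a b l ha hb ode
    exact h1.of_dvd hf ⟨X - C x, by rw [hfg]; ring⟩
  have hgy : ∀ y, x ≤ y → g.eval y ≠ 0 := by
    intro y hy h
    rcases hy.eq_or_lt with h' | h'
    · rw [h'] at hg0; exact hg0 h
    · have := hmax y (by rw [hfg]; simp [h])
      linarith
  have hprod : 0 < g.eval x * g.eval 1 := by
    by_contra! hneg
    have hivt : (0 : ℝ) ∈ Set.uIcc (g.eval x) (g.eval 1) := by
      rw [Set.mem_uIcc]
      rcases lt_or_gt_of_ne hg0 with h | h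
      · left; exact ⟨h.le, by nlinarith⟩
      · right; exact ⟨by nlinarith, h.le⟩
    obtain ⟨y, hy, hy0⟩ := intermediate_value_uIcc (g.continuous.continuousOn) hivt
    rw [Set.uIcc_of_le hx2.le] at hy
    exact hgy y hy.1 hy0
  let φ : ℝ[X] := 2 * (1 - X ^ 2) * derivative f - (C (a + b) * X + C (a - b)) * f
  have hφx : φ.eval x = 2 * (1 - x ^ 2) * g.eval x := by
    simp [φ, hfg]
  have hφ1 : φ.eval 1 = - (2 * a * (1 - x)) * g.eval 1 := by
    simp [φ, hfg]; ring
  have hφneg : φ.eval x * φ.eval 1 < 0 := by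
    rw [hφx, hφ1]
    have := mul_pos (mul_pos (mul_pos ha hxx) (sub_pos.2 hx2)) hprod
    nlinarith
  obtain ⟨y, hy, hy0⟩ : ∃ y ∈ Set.uIcc x 1, φ.eval y = 0 := by
    have hivt : (0 : ℝ) ∈ Set.uIcc (φ.eval x) (φ.eval 1) := by
      rw [Set.mem_uIcc]
      rcases le_total (φ.eval x) 0 with h | h
      · left; exact ⟨h, by nlinarith⟩
      · right; exact ⟨by nlinarith, h⟩
    exact intermediate_value_uIcc (φ.continuous.continuousOn) hivt
  rw [Set.uIcc_of_le hx2.le] at hy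
  have hxy : x < y := lt_of_le_of_ne hy.1 (fun h => by rw [h, hy0] at hφneg; simp at hφneg)
  have hy1 : y < 1 := lt_of_le_of_ne hy.2 (fun h => by rw [← h, hy0] at hφneg; simp at hφneg)
  refine ⟨y, hxy, hy1, ?_⟩
  have hD : 0 < 1 - y ^ 2 := by nlinarith
  have hL := laguerre_splits g hgs y
  have e1 : f.eval y = (y - x) * g.eval y := by rw [hfg]; simp
  have e2 : (derivative f).eval y = g.eval y + (y - x) * (derivative g).eval y := by
    rw [hfg]; simp
  have e3 : (derivative (derivative f)).eval y =
      2 * (derivative g).eval y + (y - x) * (derivative (derivative g)).eval y := by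
    rw [hfg]; simp; ring
  have ho := congrArg (eval y) ode
  simp only [eval_add, eval_sub, eval_mul, eval_pow, eval_X, eval_C, eval_one, eval_zero] at ho
  simp only [φ, eval_sub, eval_mul, eval_add, eval_C, eval_X, eval_pow, eval_one,
    eval_ofNat] at hy0
  have hL2 : (g.eval y) ^ 2 ≤ (derivative f).eval y ^ 2 -
      f.eval y * (derivative (derivative f)).eval y := by
    rw [e1, e2, e3]
    nlinarith [mul_nonneg (sq_nonneg (y - x)) (sub_nonneg.2 hL)]
  have hid : 4 * (1 - y ^ 2) ^ 2 * ((derivative f).eval y ^ 2 -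
      f.eval y * (derivative (derivative f)).eval y) =
      (4 * l * (1 - y ^ 2) - ((a + b) * y + (a - b)) ^ 2) * f.eval y ^ 2 := by
    generalize f.eval y = u at *
    generalize (derivative f).eval y = v at *
    generalize (derivative (derivative f)).eval y = w at *
    generalize 1 - y ^ 2 = D at *
    generalize (a + b) * y + (a - b) = t at *
    linear_combination (2 * D * v - t * u) * hy0 - 4 * D * u * ho
  have hg2 : 0 < g.eval y ^ 2 := by have := hgy y hxy.le; positivity
  have := mul_le_mul_of_nonneg_left hL2 (show 0 ≤ 4 * (1 - y ^ 2) ^ 2 by positivity)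
  rw [hid, e1, mul_pow, ← mul_assoc] at this
  exact le_of_mul_le_mul_right this hg2

open Polynomial in
lemma jacobi_term_ode (i j : ℕ) (a b : ℝ) :
    (1 - X ^ 2) * derivative (derivative
        ((C (1 / 2 : ℝ) * (X - 1)) ^ i * (C (1 / 2 : ℝ) * (X + 1)) ^ j)) -
      (C (a + b) * X + C (a - b)) *
        derivative ((C (1 / 2 : ℝ) * (X - 1)) ^ i * (C (1 / 2 : ℝ) * (X + 1)) ^ j)
      + C (((i : ℝ) + j) * ((i : ℝ) + j + a + b - 1)) *
        ((C (1 / 2 : ℝ) * (X - 1)) ^ i * (C (1 / 2 : ℝ) * (X + 1)) ^ j) =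
    C (j * (j + b - 1)) *
        ((C (1 / 2 : ℝ) * (X - 1)) ^ i * (C (1 / 2 : ℝ) * (X + 1)) ^ (j - 1))
      - C (i * (i + a - 1)) *
        ((C (1 / 2 : ℝ) * (X - 1)) ^ (i - 1) * (C (1 / 2 : ℝ) * (X + 1)) ^ j) := by
  apply Polynomial.funext
  intro x
  obtain ⟨u, rfl⟩ : ∃ u, x = 2 * u + 1 := ⟨(x - 1) / 2, by ring⟩
  rcases i with _ | _ | i <;> rcases j with _ | _ | j <;>
    simp [derivative_mul, derivative_pow] <;> ring

/-- coefficients of the Jacobi polynomial -/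
noncomputable def jacCoeff (k : ℕ) (α β : ℝ) (i : ℕ) : ℝ :=
    ((∏ j ∈ Finset.range (k - i), (α + (i : ℝ) + (j : ℝ) + 1)) /
      (Nat.factorial (k - i))) *
    ((∏ j ∈ Finset.range i, (β + ((k - i : ℕ) : ℝ) + (j : ℝ) + 1)) /
      (Nat.factorial i))

lemma jacCoeff_pos (k : ℕ) (α β : ℝ) (i : ℕ) (ha : -1 < α) (hb : -1 < β) :
    0 < jacCoeff k α β i := by
  unfold jacCoeff
  apply mul_pos
  · apply div_pos _ (by positivity)
    apply Finset.prod_pos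
    intro j _
    have : (0 : ℝ) ≤ (i : ℝ) + j := by positivity
    linarith
  · apply div_pos _ (by positivity)
    apply Finset.prod_pos
    intro j _
    have : (0 : ℝ) ≤ ((k - i : ℕ) : ℝ) + j := by positivity
    linarith

lemma jacCoeff_rec (i n : ℕ) (α β : ℝ) :
    jacCoeff (i + 1 + n) α β (i + 1) * (((i + 1 : ℕ) : ℝ) * ((i + 1 : ℕ) + (α + 1) - 1)) =
      jacCoeff (i + 1 + n) α β i * (((n + 1 : ℕ) : ℝ) * ((n + 1 : ℕ) + (β + 1) - 1)) := by
  unfold jacCoeff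
  rw [show i + 1 + n - (i + 1) = n by omega, show i + 1 + n - i = n + 1 by omega]
  rw [Finset.prod_range_succ' _ n, Finset.prod_range_succ' _ i]
  have e1 : ∏ j ∈ Finset.range n, (α + (i : ℝ) + ((j + 1 : ℕ) : ℝ) + 1) =
      ∏ j ∈ Finset.range n, (α + ((i + 1 : ℕ) : ℝ) + (j : ℝ) + 1) :=
    Finset.prod_congr rfl (fun j _ => by push_cast; ring)
  have e2 : ∏ j ∈ Finset.range i, (β + (n : ℝ) + ((j + 1 : ℕ) : ℝ) + 1) =
      ∏ j ∈ Finset.range i, (β + ((n + 1 : ℕ) : ℝ) + (j : ℝ) + 1) :=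
    Finset.prod_congr rfl (fun j _ => by push_cast; ring)
  rw [e1, e2, Nat.factorial_succ, Nat.factorial_succ]
  generalize ∏ j ∈ Finset.range n, (α + ((i + 1 : ℕ) : ℝ) + (j : ℝ) + 1) = p1
  generalize ∏ j ∈ Finset.range i, (β + ((n + 1 : ℕ) : ℝ) + (j : ℝ) + 1) = p2
  have := Nat.factorial_ne_zero i
  have := Nat.factorial_ne_zero n
  push_cast
  field_simp
  ring

open Polynomial in
/-- the Jacobi polynomial as a polynomial -/
noncomputable def jacPoly (k : ℕ) (α β : ℝ) : ℝ[X] :=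
  ∑ i ∈ Finset.range (k + 1), C (jacCoeff k α β i) *
    ((C (1 / 2 : ℝ) * (X - 1)) ^ i * (C (1 / 2 : ℝ) * (X + 1)) ^ (k - i))

open Polynomial in
lemma jacPoly_eval (k : ℕ) (α β x : ℝ) : (jacPoly k α β).eval x = jacobi k α β x := by
  unfold jacPoly jacobi
  rw [eval_finsetSum]
  refine Finset.sum_congr rfl (fun i _ => ?_)
  simp only [jacCoeff, eval_mul, eval_C, eval_pow, eval_sub, eval_add, eval_X, eval_one]
  rw [show (1 / 2 : ℝ) * (x - 1) = (x - 1) / 2 by ring,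
    show (1 / 2 : ℝ) * (x + 1) = (x + 1) / 2 by ring]
  ring

open Polynomial in
lemma jacPoly_ode (k : ℕ) (α β : ℝ) :
    (1 - X ^ 2) * derivative (derivative (jacPoly k α β)) -
      (C ((α + 1) + (β + 1)) * X + C ((α + 1) - (β + 1))) * derivative (jacPoly k α β)
      + C ((k : ℝ) * (k + (α + 1) + (β + 1) - 1)) * jacPoly k α β = 0 := by
  set U : ℝ[X] := C (1 / 2 : ℝ) * (X - 1) with hU
  set V : ℝ[X] := C (1 / 2 : ℝ) * (X + 1) with hV
  have hsum : (1 - X ^ 2) * derivative (derivative (jacPoly k α β)) -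
      (C ((α + 1) + (β + 1)) * X + C ((α + 1) - (β + 1))) * derivative (jacPoly k α β)
      + C ((k : ℝ) * (k + (α + 1) + (β + 1) - 1)) * jacPoly k α β =
      ∑ i ∈ Finset.range (k + 1), (C (jacCoeff k α β i) *
        (C (((k - i : ℕ) : ℝ) * ((k - i : ℕ) + (β + 1) - 1)) * (U ^ i * V ^ (k - i - 1)))
        - C (jacCoeff k α β i) *
          (C ((i : ℝ) * (i + (α + 1) - 1)) * (U ^ (i - 1) * V ^ (k - i)))) := by
    unfold jacPoly
    rw [← hU, ← hV]
    simp only [derivative_sum, Finset.mul_sum]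
    rw [← Finset.sum_sub_distrib, ← Finset.sum_add_distrib]
    refine Finset.sum_congr rfl (fun i hi => ?_)
    rw [← mul_sub, ← jacobi_term_ode i (k - i) (α + 1) (β + 1)]
    have : ((i : ℝ) + ((k - i : ℕ) : ℝ)) = k := by
      rw [← Nat.cast_add]; congr 1; have := Finset.mem_range.1 hi; omega
    rw [this, ← hU, ← hV]
    simp only [derivative_C_mul]
    ring
  rw [hsum, Finset.sum_sub_distrib]
  rw [Finset.sum_range_succ, Finset.sum_range_succ' (fun i => C (jacCoeff k α β i) *
        (C ((i : ℝ) * (i + (α + 1) - 1)) * (U ^ (i - 1) * V ^ (k - i))))]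
  have : ∀ i ∈ Finset.range k, C (jacCoeff k α β i) *
        (C (((k - i : ℕ) : ℝ) * ((k - i : ℕ) + (β + 1) - 1)) * (U ^ i * V ^ (k - i - 1))) =
      C (jacCoeff k α β (i + 1)) * (C (((i + 1 : ℕ) : ℝ) * ((i + 1 : ℕ) + (α + 1) - 1)) *
        (U ^ (i + 1 - 1) * V ^ (k - (i + 1)))) := by
    intro i hi
    obtain ⟨n, rfl⟩ := Nat.exists_eq_add_of_lt (Finset.mem_range.1 hi)
    have h := jacCoeff_rec i n α β
    rw [show i + n + 1 = i + 1 + n by ring, show i + 1 + n - i = n + 1 by omega,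
      show i + 1 + n - (i + 1) = n by omega, Nat.add_sub_cancel, Nat.add_sub_cancel,
      ← mul_assoc (C (jacCoeff (i + 1 + n) α β (i + 1))), ← C_mul, h, ← mul_assoc, ← C_mul]
  rw [Finset.sum_congr rfl this]
  simp

lemma jacobi_pos_of_ge (k : ℕ) (α β x : ℝ) (ha : -1 < α) (hb : -1 < β) (hx : 1 ≤ x) :
    0 < jacobi k α β x := by
  unfold jacobi
  apply Finset.sum_pos'
  · intro i _
    have := (jacCoeff_pos k α β i ha hb).le
    unfold jacCoeff at this
    have h1 : 0 ≤ (x - 1) / 2 := by linarith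
    have h2 : 0 ≤ (x + 1) / 2 := by linarith
    exact mul_nonneg (mul_nonneg this (pow_nonneg h1 _)) (pow_nonneg h2 _)
  · refine ⟨0, by simp, ?_⟩
    have := jacCoeff_pos k α β 0 ha hb
    unfold jacCoeff at this
    have h2 : 0 < (x + 1) / 2 := by linarith
    rw [pow_zero, mul_one]
    exact mul_pos this (pow_pos h2 _)

lemma jacobi_pos_of_le (k : ℕ) (α β x : ℝ) (ha : -1 < α) (hb : -1 < β) (hx : x ≤ -1) :
    0 < (-1) ^ k * jacobi k α β x := by
  unfold jacobi
  rw [Finset.mul_sum]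
  have hterm : ∀ i ∈ Finset.range (k + 1), (-1) ^ k * (((∏ j ∈ Finset.range (k - i), (α + (i : ℝ) + (j : ℝ) + 1)) /
      (Nat.factorial (k - i))) *
    ((∏ j ∈ Finset.range i, (β + ((k - i : ℕ) : ℝ) + (j : ℝ) + 1)) /
      (Nat.factorial i)) *
    ((x - 1) / 2) ^ i * ((x + 1) / 2) ^ (k - i)) =
      jacCoeff k α β i * ((1 - x) / 2) ^ i * ((-1 - x) / 2) ^ (k - i) := by
    intro i hi
    have hk : k = i + (k - i) := by have := Finset.mem_range.1 hi; omega
    have e : ((-1 : ℝ)) ^ k = (-1) ^ i * (-1) ^ (k - i) := by rw [← pow_add, ← hk]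
    rw [e, show (1 - x) / 2 = (-1) * ((x - 1) / 2) by ring,
      show (-1 - x) / 2 = (-1) * ((x + 1) / 2) by ring, mul_pow, mul_pow]
    unfold jacCoeff
    ring
  rw [Finset.sum_congr rfl hterm]
  have h1 : 0 < (1 - x) / 2 := by linarith
  have h2 : 0 ≤ (-1 - x) / 2 := by linarith
  apply Finset.sum_pos'
  · intro i _
    have := jacCoeff_pos k α β i ha hb
    positivity
  · refine ⟨k, by simp, ?_⟩
    have := jacCoeff_pos k α β k ha hb
    simp only [Nat.sub_self, pow_zero, mul_one]
    positivity

lemma le_one_aux (K t u : ℝ) (hK : 0 < K) (h : K * (1 - t ^ 2) - u ^ 2 = 0) : t ^ 2 ≤ 1 := by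
  by_contra! h1
  have := mul_neg_of_pos_of_neg hK (sub_neg.2 h1)
  linarith [sq_nonneg u]

set_option maxHeartbeats 2000000 in
/-- For `α ≥ β > −1`, the largest zero of `P_k^{(α,β)}` satisfies
`x_k < B − 3 (1 − B²)^{2/3} (2R)^{−1/3} + 4q(s+1)/(r² + 2s + 1)^{3/2}`. -/
theorem jacobi_largest_zero_lt
    (k : ℕ) (hk : 1 ≤ k) (α β : ℝ) (hβ : -1 < β) (hαβ : β ≤ α)
    (s q r R : ℝ)
    (hs : s = α + β + 1) (hq : q = α - β) (hr : r = 2 * (k : ℝ) + α + β + 1)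
    (hR : R = Real.sqrt ((r ^ 2 - q ^ 2 + 2 * s + 1) * (r ^ 2 - s ^ 2)))
    (B : ℝ) (hB : B = (R - q * (s + 1)) / (r ^ 2 + 2 * s + 1))
    (xk : ℝ) (hroot : jacobi k α β xk = 0)
    (hmax : ∀ y : ℝ, jacobi k α β y = 0 → y ≤ xk) :
    xk < B - 3 * (1 - B ^ 2) ^ ((2 : ℝ) / 3) * (2 * R) ^ (-(1 : ℝ) / 3)
      + 4 * q * (s + 1) / (r ^ 2 + 2 * s + 1) ^ ((3 : ℝ) / 2) := by
  have hα : -1 < α := by linarith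
  have hx2 : xk < 1 := by
    by_contra! h
    exact (jacobi_pos_of_ge k α β xk hα hβ h).ne' hroot
  have hx1 : -1 < xk := by
    by_contra! h
    have := jacobi_pos_of_le k α β xk hα hβ h
    rw [hroot] at this
    simp at this
  have hf : jacPoly k α β ≠ 0 := by
    intro h
    have h1 := jacPoly_eval k α β 1
    rw [h] at h1
    simp at h1
    exact (jacobi_pos_of_ge k α β 1 hα hβ le_rfl).ne h1
  obtain ⟨y, hxy, hy1, hy⟩ := key_point (jacPoly k α β) hf (α + 1) (β + 1) _ xk (by linarith)
    (by linarith) (jacPoly_ode k α β) (by rw [jacPoly_eval]; exact hroot)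
    (fun y h => hmax y (by rw [← jacPoly_eval]; exact h)) hx1 hx2
  have hk1 : (1 : ℝ) ≤ k := by exact_mod_cast hk
  obtain ⟨S, hS⟩ : ∃ S, S = s + 1 := ⟨_, rfl⟩
  have hS0 : 0 < S := by rw [hS, hs]; linarith
  have hq0 : 0 ≤ q := by rw [hq]; linarith
  have hqS : q < S := by rw [hS, hs, hq]; linarith
  obtain ⟨K, hK⟩ : ∃ K, K = r ^ 2 - s ^ 2 := ⟨_, rfl⟩
  have hK' : K = 4 * (k * (k + (α + 1) + (β + 1) - 1)) := by rw [hK, hr, hs]; ring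
  have hKS : 4 * S ≤ K := by
    rw [hK', hS, hs]
    nlinarith [mul_nonneg (sub_nonneg.2 hk1) (show (0 : ℝ) ≤ k + (α + β + 2) by linarith)]
  have hK0 : 0 < K := by linarith
  obtain ⟨M, hM⟩ : ∃ M, M = r ^ 2 + 2 * s + 1 := ⟨_, rfl⟩
  have hMK : M = K + S ^ 2 := by rw [hM, hK, hS]; ring
  have hM0 : 0 < M := by rw [hMK]; positivity
  have hqq : q ^ 2 < S ^ 2 := pow_lt_pow_left₀ hqS hq0 two_ne_zero
  have hMq : K < M - q ^ 2 := by rw [hMK]; linarith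
  have hprod : 0 < (M - q ^ 2) * K := mul_pos (by linarith) hK0
  have hR' : R = √((M - q ^ 2) * K) := by rw [hR, hM, hK]; congr 1; ring
  have hR0 : 0 < R := by rw [hR']; exact Real.sqrt_pos.2 hprod
  have hR2 : R ^ 2 = (M - q ^ 2) * K := by rw [hR']; exact Real.sq_sqrt hprod.le
  rw [← hS, ← hM] at hB
  rw [← hS, ← hM]
  obtain ⟨h, hh⟩ : ∃ h, h = R / M := ⟨_, rfl⟩
  obtain ⟨m, hm⟩ : ∃ m, m = q * S / M := ⟨_, rfl⟩
  have hh0 : 0 < h := by rw [hh]; positivity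
  have hm0 : 0 ≤ m := by rw [hm]; positivity
  have hBhm : B = h - m := by rw [hB, hh, hm]; ring
  have hhM : h * M = R := by rw [hh]; field_simp
  have hmM : m * M = q * S := by rw [hm]; field_simp
  -- quadratic factorization
  have hfac : ∀ y : ℝ, K * (1 - y ^ 2) - (S * y + q) ^ 2 =
      M * (h - m - y) * (y - (-h - m)) := by
    intro y
    have e : M * (M * (h - m - y) * (y - (-h - m))) =
        R ^ 2 - (M * y + q * S) ^ 2 := by
      rw [← hhM, ← hmM]; ring
    have e2 : M * (K * (1 - y ^ 2) - (S * y + q) ^ 2) = R ^ 2 - (M * y + q * S) ^ 2 := by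
      rw [hR2, hMK]; ring
    exact mul_left_cancel₀ hM0.ne' (e2.trans e.symm)
  have hB1 : (h - m) ^ 2 ≤ 1 := by
    have := hfac (h - m)
    rw [sub_self, mul_zero, zero_mul] at this
    exact le_one_aux K _ _ hK0 this
  have hA1 : (h + m) ^ 2 ≤ 1 := by
    have := hfac (-h - m)
    rw [sub_self, mul_zero] at this
    have h1 := le_one_aux K _ _ hK0 this
    linarith [show (-h - m) ^ 2 = (h + m) ^ 2 by ring]
  have hmain : 4 * (1 - y ^ 2) ^ 2 ≤ M * (h - m - y) * (y - (-h - m)) * (y - xk) ^ 2 := by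
    rw [← hfac, hK', hS, hs, hq]
    convert hy using 3
    ring
  have hyy : 0 < 1 - y ^ 2 := by
    linarith [mul_pos (show 0 < 1 - y by linarith) (show 0 < 1 + y by linarith)]
  have hpos : 0 < M * ((h - m - y) * (y - (-h - m))) := by
    by_contra! hneg
    have h1 := mul_nonpos_of_nonpos_of_nonneg hneg (sq_nonneg (y - xk))
    rw [← mul_assoc] at h1
    have h2 := pow_pos hyy 2
    linarith
  have hpos2 : 0 < (h - m - y) * (y - (-h - m)) := pos_of_mul_pos_right hpos hM0.le
  have hyr : y < h - m := by
    by_contra! hge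
    have := mul_nonpos_of_nonpos_of_nonneg (show h - m - y ≤ 0 by linarith)
      (show 0 ≤ y - (-h - m) by linarith)
    linarith
  have hyl : -h - m < y := by
    by_contra! hge
    have := mul_nonpos_of_nonneg_of_nonpos (show 0 ≤ h - m - y by linarith)
      (show y - (-h - m) ≤ 0 by linarith)
    linarith
  have hE0 : 0 < √M := Real.sqrt_pos.2 hM0
  have hE2 : √M ^ 2 = M := Real.sq_sqrt hM0.le
  have hhm : 4 * m ≤ h * √M := by
    refine le_of_pow_le_pow_left₀ two_ne_zero (by positivity) ?_
    rw [mul_pow, mul_pow, hE2]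
    have h1 : 16 * (q * S) ^ 2 ≤ M * R ^ 2 := by
      have a1 : 16 * S ^ 2 ≤ (M - q ^ 2) * K := by
        have := mul_le_mul (hKS.trans hMq.le) hKS (by positivity) (by linarith)
        linarith
      have a2 : q ^ 2 ≤ M := by linarith
      rw [hR2]
      have := mul_le_mul a2 a1 (by positivity) hM0.le
      linarith
    rw [← hhM, ← hmM] at h1
    have h2 : M ^ 2 * ((4 : ℝ) ^ 2 * m ^ 2) ≤ M ^ 2 * (h ^ 2 * M) := by linarith
    exact le_of_mul_le_mul_left h2 (by positivity)
  have hfin := final_aux M h m xk y (√M) _ hE0 hE2 hh0 hm0 hB1 hA1 hyr hyl hxy hmain hhm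
    (fun η hη => amgm_aux (1 - (h - m) ^ 2) (2 * (h * M)) η (by linarith) (by positivity) hη)
  have hM32 : M ^ ((3 : ℝ) / 2) = M * √M := by
    rw [show (3 : ℝ) / 2 = 1 + 1 / 2 by norm_num, Real.rpow_add hM0, Real.rpow_one,
      Real.sqrt_eq_rpow]
  have hlast : 4 * q * S / M ^ ((3 : ℝ) / 2) = 4 * m / √M := by
    rw [hM32, hm]; field_simp
  rw [hlast, hBhm, ← hhM]
  exact hfin
end

section
/- Let k ≥ 30 and −1 < α ≤ 2(3 + 2√3)k − 1. Then the largest zero x_k of the generalized Laguerre polynomial L_k^{(α)} satisfies x_k > U² − 9·U^{4/3} / (2·(U² − V²)^{1/3}), where V = √(k+α+1) − √k and U = √(k+α+1) + √k. -/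
/-- Coefficients of the Laguerre polynomial. -/
noncomputable def lagC (k : ℕ) (α : ℝ) (i : ℕ) : ℝ :=
  ((-1 : ℝ) ^ i / (Nat.factorial i)) *
      ((∏ j ∈ Finset.range (k - i), (α + (i : ℝ) + (j : ℝ) + 1)) /
        (Nat.factorial (k - i)))

/-- The Laguerre polynomial as a `Polynomial`. -/
noncomputable def lagP (k : ℕ) (α : ℝ) : Polynomial ℝ :=
  ∑ i ∈ Finset.range (k + 1), Polynomial.C (lagC k α i) * Polynomial.X ^ i

lemma lagP_eval (k : ℕ) (α x : ℝ) : (lagP k α).eval x = laguerre k α x := by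
  simp [lagP, laguerre, lagC, Polynomial.eval_finsetSum]

lemma lagP_coeff (k : ℕ) (α : ℝ) (n : ℕ) :
    (lagP k α).coeff n = if n < k + 1 then lagC k α n else 0 := by
  simp [lagP, Polynomial.coeff_X_pow]

lemma lagC_rec (k : ℕ) (α : ℝ) (i : ℕ) (h : i < k) :
    ((i : ℝ) + 1) * (i + 1 + α) * lagC k α (i + 1) = - ((k : ℝ) - i) * lagC k α i := by
  obtain ⟨m, rfl⟩ : ∃ m, k = i + 1 + m := ⟨k - (i + 1), by omega⟩
  have h1 : i + 1 + m - (i + 1) = m := by omega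
  have h2 : i + 1 + m - i = m + 1 := by omega
  unfold lagC
  rw [h1, h2, Finset.prod_range_succ']
  have e : ∏ j ∈ Finset.range m, (α + ((i + 1 : ℕ) : ℝ) + (j : ℝ) + 1)
      = ∏ j ∈ Finset.range m, (α + (i : ℝ) + ((j + 1 : ℕ) : ℝ) + 1) := by
    apply Finset.prod_congr rfl
    intro j _
    push_cast
    ring
  rw [e, Nat.factorial_succ i, Nat.factorial_succ m]
  generalize ∏ j ∈ Finset.range m, (α + (i : ℝ) + ((j + 1 : ℕ) : ℝ) + 1) = R
  have f1 : (Nat.factorial i : ℝ) ≠ 0 := by positivity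
  have f2 : (Nat.factorial m : ℝ) ≠ 0 := by positivity
  have f3 : (i : ℝ) + 1 ≠ 0 := by positivity
  have f4 : (m : ℝ) + 1 ≠ 0 := by positivity
  push_cast
  field_simp
  ring

lemma lagP_rec (k : ℕ) (α : ℝ) (i : ℕ) :
    ((i : ℝ) + 1) * (i + 1 + α) * (lagP k α).coeff (i + 1)
      = - ((k : ℝ) - i) * (lagP k α).coeff i := by
  rw [lagP_coeff, lagP_coeff]
  rcases lt_trichotomy i k with h | h | h
  · rw [if_pos (by omega), if_pos (by omega)]
    exact lagC_rec k α i h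
  · subst h; simp
  · rw [if_neg (by omega), if_neg (by omega)]; simp

open Polynomial in
lemma lagP_ode (k : ℕ) (α : ℝ) :
    X * derivative (derivative (lagP k α)) + C (α + 1) * derivative (lagP k α)
      - X * derivative (lagP k α) + C (k : ℝ) * lagP k α = 0 := by
  ext n
  have h := lagP_rec k α n
  rcases n with _ | n
  · simp [coeff_derivative] at h ⊢
    linarith
  · simp only [coeff_add, coeff_sub, coeff_X_mul, coeff_C_mul, coeff_derivative, coeff_zero]
    push_cast at h ⊢
    linarith

open Polynomial in
lemma lagP_ode_eval (k : ℕ) (α x : ℝ) :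
    x * (derivative (derivative (lagP k α))).eval x
      + (α + 1 - x) * (derivative (lagP k α)).eval x + k * (lagP k α).eval x = 0 := by
  have h := congrArg (Polynomial.eval x) (lagP_ode k α)
  simp only [eval_add, eval_sub, eval_mul, eval_X, eval_C, eval_zero] at h
  linarith

/-- Sturm-type oscillation criterion with the test function `(x - A) (A + L - x)`. -/
lemma sturm_aux (k : ℕ) (α A L κ τ : ℝ) (hA : 0 < A) (hL : 0 < L)
    (hne : ∀ x, A ≤ x → (lagP k α).eval x ≠ 0)
    (hQ : ∀ x, A ≤ x → κ * (τ - (x - A)) ≤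
      (-x ^ 2 + 2 * (2 * k + α + 1) * x + 1 - α ^ 2) / (4 * x ^ 2)) :
    κ * (τ * L ^ 5 / 30 - L ^ 6 / 60) ≤ L ^ 3 / 3 := by
  set P := lagP k α with hP
  let v : ℝ → ℝ := fun x => P.derivative.eval x / P.eval x + (α + 1) / (2 * x) - 1 / 2
  let F : ℝ → ℝ := fun x => L ^ 2 * (x - A) - 2 * L * (x - A) ^ 2 + 4 / 3 * (x - A) ^ 3
    - κ * (τ * (L ^ 2 * (x - A) ^ 3 / 3 - L * (x - A) ^ 4 / 2 + (x - A) ^ 5 / 5)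
      - (L ^ 2 * (x - A) ^ 4 / 4 - 2 * L * (x - A) ^ 5 / 5 + (x - A) ^ 6 / 6))
  let G : ℝ → ℝ := fun x => ((x - A) * (L - (x - A))) ^ 2 * v x - F x
  have hv : ∀ x, A ≤ x → HasDerivAt v
      (-((-x ^ 2 + 2 * (2 * k + α + 1) * x + 1 - α ^ 2) / (4 * x ^ 2)) - v x ^ 2) x := by
    intro x hx
    have hx0 : x ≠ 0 := by linarith
    have hp := hne x hx
    have d1 := (P.derivative.hasDerivAt x).div (P.hasDerivAt x) hp
    have d2 := (((hasDerivAt_id x).const_mul 2).inv (by simpa using hx0)).const_mul (α + 1)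
    have d3 := (d1.add d2).sub_const (1 / 2)
    have ode := lagP_ode_eval k α x
    rw [← hP] at ode
    have e : P.derivative.derivative.eval x
        = (-(α + 1 - x) * P.derivative.eval x - k * P.eval x) / x := by
      field_simp
      linarith
    refine (d3.congr_deriv ?_).congr_of_eventuallyEq ?_
    · simp only [v, id, e]
      field_simp
      ring
    · refine Filter.Eventually.of_forall fun z => ?_
      simp [v, div_eq_mul_inv]
  have hF : ∀ x, HasDerivAt F ((L - 2 * (x - A)) ^ 2
      - κ * (τ - (x - A)) * ((x - A) * (L - (x - A))) ^ 2) x := by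
    intro x
    have s := (hasDerivAt_id x).sub_const A
    have a1 := s.const_mul (L ^ 2)
    have a2 := (s.pow 2).const_mul (2 * L)
    have a3 := (s.pow 3).const_mul (4 / 3 : ℝ)
    have b1 := (((s.pow 3).const_mul (L ^ 2)).div_const 3)
    have b2 := (((s.pow 4).const_mul L).div_const 2)
    have b3 := (s.pow 5).div_const 5
    have c1 := (((s.pow 4).const_mul (L ^ 2)).div_const 4)
    have c2 := (((s.pow 5).const_mul (2 * L)).div_const 5)
    have c3 := (s.pow 6).div_const 6
    have t := ((a1.sub a2).add a3).sub
      (((((b1.sub b2).add b3).const_mul τ).sub ((c1.sub c2).add c3)).const_mul κ)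
    refine t.congr_deriv ?_
    simp
    ring
  have hG : ∀ x, A ≤ x → HasDerivAt G
      (2 * ((x - A) * (L - (x - A))) * (L - 2 * (x - A)) * v x
        + ((x - A) * (L - (x - A))) ^ 2 *
          (-((-x ^ 2 + 2 * (2 * k + α + 1) * x + 1 - α ^ 2) / (4 * x ^ 2)) - v x ^ 2)
        - ((L - 2 * (x - A)) ^ 2
      - κ * (τ - (x - A)) * ((x - A) * (L - (x - A))) ^ 2)) x := by
    intro x hx
    have s := (hasDerivAt_id x).sub_const A
    have t := (((s.mul (s.const_sub L)).pow 2).mul (hv x hx)).sub (hF x)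
    refine t.congr_deriv ?_
    simp only [Pi.pow_apply, Pi.mul_apply, id, Nat.add_one_sub_one, pow_one]
    push_cast
    ring
  have hanti : AntitoneOn G (Set.Icc A (A + L)) := by
    refine antitoneOn_of_deriv_nonpos (convex_Icc _ _)
      (fun x hx => (hG x hx.1).continuousAt.continuousWithinAt)
      (fun x hx => (hG x (interior_subset hx).1).differentiableAt.differentiableWithinAt) ?_
    intro x hx
    have hx' := (interior_subset hx).1
    rw [(hG x hx').deriv]
    have q := mul_le_mul_of_nonneg_left (hQ x hx') (sq_nonneg ((x - A) * (L - (x - A))))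
    nlinarith [sq_nonneg ((x - A) * (L - (x - A)) * v x - (L - 2 * (x - A)))]
  have h := hanti (Set.left_mem_Icc.2 (by linarith)) (Set.right_mem_Icc.2 (by linarith))
    (by linarith : A ≤ A + L)
  simp only [G, F] at h
  ring_nf at h
  nlinarith [h]

set_option maxHeartbeats 1000000 in
/-- For `k ≥ 30` and `−1 < α ≤ 2(3 + 2√3)k − 1`, the largest zero of `L_k^{(α)}`
satisfies `x_k > U² − 9 U^{4/3} / (2 (U² − V²)^{1/3})`. -/
theorem laguerre_largest_zero_gt_small_alpha
    (k : ℕ) (hk : 30 ≤ k) (α : ℝ) (hα : -1 < α)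
    (hαle : α ≤ 2 * (3 + 2 * Real.sqrt 3) * (k : ℝ) - 1)
    (V U : ℝ) (hV : V = Real.sqrt ((k : ℝ) + α + 1) - Real.sqrt (k : ℝ))
    (hU : U = Real.sqrt ((k : ℝ) + α + 1) + Real.sqrt (k : ℝ))
    (xk : ℝ) (hroot : laguerre k α xk = 0)
    (hmax : ∀ y : ℝ, laguerre k α y = 0 → y ≤ xk) :
    xk > U ^ 2 - 9 * U ^ ((4 : ℝ) / 3) / (2 * (U ^ 2 - V ^ 2) ^ ((1 : ℝ) / 3)) := by
  by_contra hcon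
  push Not at hcon
  have hk' : (30 : ℝ) ≤ k := by exact_mod_cast hk
  set p := Real.sqrt ((k : ℝ) + α + 1) with hp
  set r := Real.sqrt (k : ℝ) with hr
  have hp2 : p ^ 2 = k + α + 1 := Real.sq_sqrt (by linarith)
  have hr2 : r ^ 2 = k := Real.sq_sqrt (by linarith)
  have hr0 : 0 < r := Real.sqrt_pos.2 (by linarith)
  have hpr : r ≤ p := Real.sqrt_le_sqrt (by linarith)
  have h3 : Real.sqrt 3 ^ 2 = 3 := Real.sq_sqrt (by norm_num)
  have h30 : 0 ≤ Real.sqrt 3 := Real.sqrt_nonneg 3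
  have h31 : 1 ≤ Real.sqrt 3 := by nlinarith
  have hple : p ≤ (2 + Real.sqrt 3) * r := by
    refine (pow_le_pow_iff_left₀ (by linarith) (by positivity) two_ne_zero).1 ?_
    nlinarith
  have hquad : p ^ 2 - 4 * p * r + r ^ 2 ≤ 0 := by
    have : 0 ≤ ((2 + Real.sqrt 3) * r - p) * (p - (2 - Real.sqrt 3) * r) :=
      mul_nonneg (by linarith) (by nlinarith)
    nlinarith
  have hW : (120 : ℝ) ≤ U ^ 2 := by rw [hU]; nlinarith
  have hZ : 3 * V ^ 2 ≤ U ^ 2 := by rw [hU, hV]; nlinarith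
  have hU0 : 0 < U := by rw [hU]; linarith
  have hUV : U * V = α + 1 := by rw [hU, hV]; nlinarith
  have hsum : U ^ 2 + V ^ 2 = 2 * (2 * k + α + 1) := by rw [hU, hV]; nlinarith
  have hD : 0 < U ^ 2 - V ^ 2 := by linarith
  set D := U ^ 2 - V ^ 2 with hDdef
  obtain ⟨h, hh⟩ : ∃ h, h = U ^ ((4 : ℝ) / 3) / D ^ ((1 : ℝ) / 3) := ⟨_, rfl⟩
  have hh0 : 0 < h := by rw [hh]; positivity
  have hh3 : h ^ 3 = U ^ 4 / D := by
    rw [hh, div_pow, ← Real.rpow_natCast, ← Real.rpow_natCast, ← Real.rpow_mul hU0.le,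
      ← Real.rpow_mul hD.le]
    norm_num
  have hX : xk ≤ U ^ 2 - 9 / 2 * h := by
    refine hcon.trans (le_of_eq ?_)
    rw [hh]
    field_simp
  have hh3' : h ^ 3 * D = U ^ 4 := by rw [hh3]; field_simp
  have hDW : 2 * U ^ 2 ≤ 3 * D := by linarith
  have hh3le : h ^ 3 ≤ 3 / 2 * U ^ 2 := by
    rw [hh3, div_le_iff₀ hD]
    nlinarith
  have hhle : 44 / 5 * h ≤ U ^ 2 := by
    by_contra hc
    push Not at hc
    have c1 : (U ^ 2) ^ 3 ≤ (44 / 5 * h) ^ 3 := pow_le_pow_left₀ (by positivity) hc.le 3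
    nlinarith [mul_nonneg (sq_nonneg U) (sub_nonneg.2 hW), mul_nonneg (mul_nonneg (sq_nonneg U) (sq_nonneg U)) (sub_nonneg.2 hW)]
  have key := sturm_aux k α (U ^ 2 - 22 / 5 * h) (5 * h) (1 / (4 * h ^ 3)) (22 / 5 * h)
    (by linarith) (by linarith) ?_ ?_
  · have : (1 / (4 * h ^ 3)) * (22 / 5 * h * (5 * h) ^ 5 / 30 - (5 * h) ^ 6 / 60)
        = 2375 / 48 * h ^ 3 := by
      field_simp
      ring
    rw [this] at key
    have : 0 < h ^ 3 := by positivity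
    nlinarith
  · intro x hx h0
    rw [lagP_eval] at h0
    have := hmax x h0
    linarith
  · intro x hx
    have hx0 : 0 < x := by linarith
    have e1 : 1 / (4 * h ^ 3) * (22 / 5 * h - (x - (U ^ 2 - 22 / 5 * h)))
        = D * (U ^ 2 - x) / (4 * U ^ 4) := by
      rw [← hh3']
      field_simp
      ring
    have e2 : (-x ^ 2 + 2 * (2 * k + α + 1) * x + 1 - α ^ 2)
        = (U ^ 2 - x) * (x - V ^ 2) + 2 * (α + 1) := by
      rw [← hsum]
      have : (U * V) ^ 2 = (α + 1) ^ 2 := by rw [hUV]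
      linarith
    rw [e1, e2, div_le_div_iff₀ (by positivity) (by positivity)]
    have hxh : U ^ 2 ≤ 2 * x := by linarith
    have m1 : 0 ≤ D * x - V ^ 2 * U ^ 2 := by nlinarith
    have m2 := mul_nonneg (sq_nonneg (U ^ 2 - x)) m1
    have m3 : 0 ≤ 2 * (α + 1) * U ^ 4 := mul_nonneg (by linarith) (by positivity)
    have e3 : (U ^ 2 - x) * (x - V ^ 2) * U ^ 4 - D * (U ^ 2 - x) * x ^ 2
        = (U ^ 2 - x) ^ 2 * (D * x - V ^ 2 * U ^ 2) := by
      rw [hDdef]; ring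
    linarith
end
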